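/- arXiv:2211.11329 — 2 statements merged into one kernel-verified Lean document; each statement's English description precedes it below -/
import Mathlib

section
/- (Modified Helmholtz–Kirchhoff identity, Lemma 2.1 of the paper) Suppose G assigns to each y ∈ ℝ² with y₂ ≠ 0 a locally integrable function G(·, y) : ℝ² → ℂ that is a distributional solution of ΔG(·,y) + κ₀²G(·,y) = −δ_y, has the standard logarithmic singularity at y, is source-regular at y, and satisfies the two-layer radiation decay. Then for every R > 0 and all x, z ∈ ℝ² with |x| < R, |z| < R, x₂ ≠ 0, z₂ ≠ 0 and x ≠ z, one has ∫_{∂B_R} ( conj(G(ξ,x)) ∂_νG(ξ,z) − conj(∂_νG(ξ,x)) G(ξ,z) ) ds(ξ) = 2i · Im G(x,z), where conj denotes complex conjugation. -/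
noncomputable section
open MeasureTheory Real Filter Topology

/-- Points of the plane ℝ². -/
abbrev Pt : Type := EuclideanSpace ℝ (Fin 2)

/-- The point with coordinates (a, b). -/
def pt (a b : ℝ) : Pt := (WithLp.equiv 2 (Fin 2 → ℝ)).symm ![a, b]

/-- The point ρ·(cos θ, sin θ) on the circle of radius ρ. -/
def ptc (ρ θ : ℝ) : Pt := pt (ρ * Real.cos θ) (ρ * Real.sin θ)

/-- The Laplacian of a complex-valued function on ℝ². -/
def lap (u : Pt → ℂ) (x : Pt) : ℂ :=
  fderiv ℝ (fun y => fderiv ℝ u y (pt 1 0)) x (pt 1 0) +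
  fderiv ℝ (fun y => fderiv ℝ u y (pt 0 1)) x (pt 0 1)

/-- Radial (outward normal) derivative on a circle centered at the origin: ∇F(ξ)·(ξ/|ξ|). -/
def dnu (F : Pt → ℂ) (ξ : Pt) : ℂ := fderiv ℝ F ξ ((‖ξ‖⁻¹ : ℝ) • ξ)

/-- Integral over the circle ∂B_ρ: ∫₀^{2π} F(ρ cos θ, ρ sin θ) ρ dθ (complex valued). -/
def circInt (ρ : ℝ) (F : Pt → ℂ) : ℂ := ∫ θ in (0:ℝ)..(2 * π), F (ptc ρ θ) * (ρ : ℂ)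

/-- Integral over the circle ∂B_ρ: ∫₀^{2π} F(ρ cos θ, ρ sin θ) ρ dθ (real valued). -/
def circIntR (ρ : ℝ) (F : Pt → ℝ) : ℝ := ∫ θ in (0:ℝ)..(2 * π), F (ptc ρ θ) * ρ

/-- The background two-layer wavenumber κ₀ : equal to κ₁ on {x₂ > 0} and κ₂ on {x₂ ≤ 0}. -/
def kappa0 (κ1 κ2 : ℝ) (x : Pt) : ℝ := if 0 < x 1 then κ1 else κ2

/-- w is a distributional solution of Δw + κ₀²w = −δ_y. -/
def IsPointSourceSol (κ1 κ2 : ℝ) (w : Pt → ℂ) (y : Pt) : Prop :=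
  ∀ φ : Pt → ℂ, ContDiff ℝ (⊤ : ℕ∞) φ → HasCompactSupport φ →
    (∫ ξ : Pt, w ξ * (lap φ ξ + ((kappa0 κ1 κ2 ξ : ℝ) : ℂ) ^ 2 * φ ξ)) = -φ y

/-- w has the standard logarithmic singularity −(1/2π) log|ξ − y| at y. -/
def HasLogSingularity (w : Pt → ℂ) (y : Pt) : Prop :=
  ∃ U : Set Pt, IsOpen U ∧ y ∈ U ∧ ∃ h : Pt → ℂ, ContDiffOn ℝ 1 h U ∧
    ∀ ξ ∈ U \ {y}, w ξ = -(((1 / (2 * π) : ℝ)) : ℂ) * (Real.log ‖ξ - y‖ : ℂ) + h ξ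

/-- w is source-regular at y: C¹ off the source point, C² off the interface and source point. -/
def SourceRegular (w : Pt → ℂ) (y : Pt) : Prop :=
  ContDiffOn ℝ 1 w {y}ᶜ ∧ ContDiffOn ℝ 2 w ({x : Pt | 0 < x 1} \ {y}) ∧
    ContDiffOn ℝ 2 w ({x : Pt | x 1 < 0} \ {y})

/-- w satisfies the two-layer radiation decay. -/
def RadiationDecay (κ1 κ2 : ℝ) (w : Pt → ℂ) : Prop :=
  ∃ C > (0:ℝ), ∃ ρ₀ > (0:ℝ), ∀ ξ : Pt, ρ₀ ≤ ‖ξ‖ →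
    ‖w ξ‖ ≤ C * ‖ξ‖ ^ (-(1/2) : ℝ) ∧
    ‖dnu w ξ - Complex.I * ((kappa0 κ1 κ2 ξ : ℝ) : ℂ) * w ξ‖ ≤ C * ‖ξ‖ ^ (-(3/2) : ℝ)

@[simp] lemma pt_zero (a b : ℝ) : pt a b 0 = a := rfl

@[simp] lemma pt_one (a b : ℝ) : pt a b 1 = b := rfl

lemma eq_smul_add_smul (ξ : Pt) : ξ = ξ 0 • pt 1 0 + ξ 1 • pt 0 1 := by
  ext i; fin_cases i <;> simp [pt]

lemma clm_eq_coord (L : Pt →L[ℝ] ℂ) (ξ : Pt) :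
    L ξ = (ξ 0 : ℂ) * L (pt 1 0) + (ξ 1 : ℂ) * L (pt 0 1) := by
  conv_lhs => rw [eq_smul_add_smul ξ]
  simp

/-- The identification of `ℝ × ℝ` with the plane, as a continuous linear map. -/
def ptL : ℝ × ℝ →L[ℝ] Pt :=
  (ContinuousLinearMap.fst ℝ ℝ ℝ).smulRight (pt 1 0) +
    (ContinuousLinearMap.snd ℝ ℝ ℝ).smulRight (pt 0 1)

lemma ptL_apply (p : ℝ × ℝ) : ptL p = pt p.1 p.2 := by
  conv_rhs => rw [eq_smul_add_smul (pt p.1 p.2)]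
  simp [ptL]

lemma integral_eq_integral_pt (f : Pt → ℂ) : ∫ ξ, f ξ = ∫ p : ℝ × ℝ, f (pt p.1 p.2) := by
  have h1 := (EuclideanSpace.volume_preserving_symm_measurableEquiv_toLp (Fin 2)).symm
  have h2 := (volume_preserving_finTwoArrow ℝ).symm
  rw [← h1.integral_comp (MeasurableEquiv.measurableEmbedding _),
    ← h2.integral_comp (MeasurableEquiv.measurableEmbedding _)]
  rfl

lemma norm_pt_sq (a b : ℝ) : ‖pt a b‖ ^ 2 = a ^ 2 + b ^ 2 := by
  simp [EuclideanSpace.norm_sq_eq]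

lemma abs_coord_le_norm (ξ : Pt) (i : Fin 2) : |ξ i| ≤ ‖ξ‖ := by
  simpa using PiLp.norm_apply_le ξ i

/-- The divergence theorem on a box `[-M, M] × [c, d]` that does not cross the horizontal axis,
for a field whose horizontal component vanishes on the vertical sides. -/
lemma box_divergence {f g D : Pt → ℂ} (hf : Continuous f) (hg : Continuous g)
    (hD : Continuous D)
    (hfd : ∀ ξ : Pt, ξ 1 ≠ 0 → DifferentiableAt ℝ f ξ)
    (hgd : ∀ ξ : Pt, ξ 1 ≠ 0 → DifferentiableAt ℝ g ξ)
    (hDfg : ∀ ξ : Pt, ξ 1 ≠ 0 → D ξ = fderiv ℝ f ξ (pt 1 0) + fderiv ℝ g ξ (pt 0 1))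
    {M c d : ℝ} (hcd : c ≤ d) (h0 : 0 ≤ c ∨ d ≤ 0)
    (hf0 : ∀ ξ : Pt, M ≤ |ξ 0| → f ξ = 0) :
    (∫ a in (-M)..M, ∫ b in c..d, D (pt a b)) =
      (∫ a in (-M)..M, g (pt a d)) - ∫ a in (-M)..M, g (pt a c) := by
  have hne : ∀ p ∈ Set.Ioo (min (-M) M) (max (-M) M) ×ˢ Set.Ioo (min c d) (max c d) \ ∅,
      ptL p 1 ≠ 0 := by
    rintro ⟨a, b⟩ ⟨⟨-, hb⟩, -⟩
    rw [min_eq_left hcd, max_eq_right hcd] at hb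
    rw [ptL_apply]
    simp only [pt_one]
    rcases h0 with h | h
    · exact (h.trans_lt hb.1).ne'
    · exact (hb.2.trans_le h).ne
  have key := integral2_divergence_prod_of_hasFDerivAt_off_countable
    (fun p => f (ptL p)) (fun p => g (ptL p))
    (fun p => (fderiv ℝ f (ptL p)).comp ptL) (fun p => (fderiv ℝ g (ptL p)).comp ptL)
    (-M) c M d ∅ Set.countable_empty
    (by fun_prop) (by fun_prop)
    (fun p hp => ((hfd _ (hne p hp)).hasFDerivAt).comp p ptL.hasFDerivAt)
    (fun p hp => ((hgd _ (hne p hp)).hasFDerivAt).comp p ptL.hasFDerivAt) ?_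
  · simp only [ContinuousLinearMap.comp_apply, ptL_apply] at key
    have e1 : ∀ b, f (pt M b) = 0 := fun b => hf0 _ (by simp [le_abs_self])
    have e2 : ∀ b, f (pt (-M) b) = 0 := fun b => hf0 _ (by simp [le_abs_self])
    simp only [e1, e2, intervalIntegral.integral_zero, add_zero, sub_zero] at key
    rw [← key]
    refine intervalIntegral.integral_congr fun a _ => ?_
    refine intervalIntegral.integral_congr_ae ?_
    have : ∀ᵐ b : ℝ, b ≠ 0 := by simp [ae_iff]
    filter_upwards [this] with b hb _
    exact hDfg _ (by simpa using hb)
  · have hcpt : IsCompact (Set.uIcc (-M) M ×ˢ Set.uIcc c d) :=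
      isCompact_uIcc.prod isCompact_uIcc
    have hi : IntegrableOn (fun p : ℝ × ℝ => D (ptL p)) (Set.uIcc (-M) M ×ˢ Set.uIcc c d) :=
      (by fun_prop : Continuous fun p : ℝ × ℝ => D (ptL p)).continuousOn.integrableOn_compact hcpt
    refine hi.congr_fun_ae ?_
    have h2 : ∀ᵐ p : ℝ × ℝ, p.2 ≠ 0 := by
      have hq : Measure.QuasiMeasurePreserving (Prod.snd : ℝ × ℝ → ℝ) volume volume :=
        Measure.quasiMeasurePreserving_snd
      exact hq.ae (by simp [ae_iff] : ∀ᵐ b : ℝ, b ≠ 0)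
    filter_upwards [ae_restrict_of_ae h2] with p hp
    have := hDfg (ptL p) (by rw [ptL_apply]; simpa using hp)
    simpa [ptL_apply] using this

/-- The divergence of a compactly supported field that is continuous, and differentiable off the
horizontal axis, integrates to zero. -/
lemma integral_divergence_eq_zero {f g D : Pt → ℂ} (hf : Continuous f) (hg : Continuous g)
    (hD : Continuous D) (hfs : HasCompactSupport f) (hgs : HasCompactSupport g)
    (hDs : HasCompactSupport D)
    (hfd : ∀ ξ : Pt, ξ 1 ≠ 0 → DifferentiableAt ℝ f ξ)
    (hgd : ∀ ξ : Pt, ξ 1 ≠ 0 → DifferentiableAt ℝ g ξ)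
    (hDfg : ∀ ξ : Pt, ξ 1 ≠ 0 → D ξ = fderiv ℝ f ξ (pt 1 0) + fderiv ℝ g ξ (pt 0 1)) :
    ∫ ξ, D ξ = 0 := by
  have hbd : ∀ h : Pt → ℂ, HasCompactSupport h →
      ∃ M > 0, ∀ ξ : Pt, ∀ i, M ≤ |ξ i| → h ξ = 0 := by
    intro h hh
    obtain ⟨M, hM, hsub⟩ := hh.isCompact.isBounded.subset_ball_lt 0 (0 : Pt)
    refine ⟨M, hM, fun ξ i hi => ?_⟩
    by_contra hne
    have := hsub (subset_tsupport _ hne)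
    rw [mem_ball_zero_iff] at this
    linarith [abs_coord_le_norm ξ i]
  obtain ⟨M1, hM1, h1⟩ := hbd f hfs
  obtain ⟨M2, -, h2⟩ := hbd g hgs
  obtain ⟨M3, -, h3⟩ := hbd D hDs
  obtain ⟨M, hMpos, le1, le2, le3⟩ : ∃ M > 0, M1 ≤ M ∧ M2 ≤ M ∧ M3 ≤ M :=
    ⟨max M1 (max M2 M3), by positivity, le_max_left _ _,
      (le_max_left _ _).trans (le_max_right _ _), (le_max_right _ _).trans (le_max_right _ _)⟩
  have hc : Continuous (fun p : ℝ × ℝ => pt p.1 p.2) := by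
    simpa only [← ptL_apply] using ptL.continuous
  have hcD : Continuous (fun p : ℝ × ℝ => D (pt p.1 p.2)) := hD.comp hc
  have hcDb : ∀ a, Continuous (fun b => D (pt a b)) := fun a =>
    hcD.comp (by fun_prop : Continuous fun b : ℝ => (a, b))
  have hup := box_divergence hf hg hD hfd hgd hDfg hMpos.le (Or.inl le_rfl)
    (fun ξ hξ => h1 ξ 0 (le1.trans hξ))
  have hlo := box_divergence hf hg hD hfd hgd hDfg (c := -M) (d := 0) (M := M) (by linarith)
    (Or.inr le_rfl) (fun ξ hξ => h1 ξ 0 (le1.trans hξ))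
  have e1 : ∀ a, g (pt a M) = 0 := fun a => h2 _ 1 (by simpa [abs_of_pos hMpos] using le2)
  have e2 : ∀ a, g (pt a (-M)) = 0 := fun a => h2 _ 1 (by simpa [abs_of_pos hMpos] using le2)
  simp only [e1, e2, intervalIntegral.integral_zero, zero_sub, sub_zero] at hup hlo
  have hsum : ∫ a in (-M)..M, ∫ b in (-M)..M, D (pt a b) = 0 := by
    have hci : ∀ c d : ℝ, Continuous fun a => ∫ b in c..d, D (pt a b) := fun c d =>
      intervalIntegral.continuous_parametric_intervalIntegral_of_continuous' hcD c d
    rw [intervalIntegral.integral_congr (g := fun a => (∫ b in (-M)..0, D (pt a b)) +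
        ∫ b in (0 : ℝ)..M, D (pt a b)) (fun a _ =>
          (intervalIntegral.integral_add_adjacent_intervals
            ((hcDb a).intervalIntegrable _ _) ((hcDb a).intervalIntegrable _ _)).symm),
      intervalIntegral.integral_add ((hci _ _).intervalIntegrable _ _)
        ((hci _ _).intervalIntegrable _ _), hup, hlo]
    ring
  rw [integral_eq_integral_pt, ← setIntegral_eq_integral_of_forall_compl_eq_zero
    (s := Set.Ioc (-M) M ×ˢ Set.Ioc (-M) M)]
  · have hi : IntegrableOn (fun p : ℝ × ℝ => D (pt p.1 p.2))
        (Set.Ioc (-M) M ×ˢ Set.Ioc (-M) M) (volume.prod volume) :=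
      (hcD.continuousOn.integrableOn_compact (isCompact_Icc.prod isCompact_Icc)).mono_set
        (Set.prod_mono Set.Ioc_subset_Icc_self Set.Ioc_subset_Icc_self)
    rw [← hsum, Measure.volume_eq_prod, setIntegral_prod _ hi,
      intervalIntegral.integral_of_le (by linarith)]
    refine setIntegral_congr_fun measurableSet_Ioc fun a _ => ?_
    exact (intervalIntegral.integral_of_le (by linarith)).symm
  · rintro ⟨a, b⟩ hp
    by_contra hne
    refine hp ⟨?_, ?_⟩
    · have := lt_of_not_ge fun h => hne (h3 (pt a b) 0 (le3.trans h))
      simp only [pt_zero, abs_lt] at this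
      exact ⟨this.1, this.2.le⟩
    · have := lt_of_not_ge fun h => hne (h3 (pt a b) 1 (le3.trans h))
      simp only [pt_one, abs_lt] at this
      exact ⟨this.1, this.2.le⟩

/-- The component along `e` of the field `u ∇v - v ∇u`. -/
def wronskian (u v : Pt → ℂ) (e ξ : Pt) : ℂ := u ξ * fderiv ℝ v ξ e - v ξ * fderiv ℝ u ξ e

lemma contDiffAt_fderiv_apply {u : Pt → ℂ} {ξ : Pt} (hu : ContDiffAt ℝ 2 u ξ) (e : Pt) :
    ContDiffAt ℝ 1 (fun y => fderiv ℝ u y e) ξ :=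
  (hu.fderiv_right (m := 1) (by norm_num)).clm_apply contDiffAt_const

lemma continuousAt_fderiv_apply {u : Pt → ℂ} {ξ : Pt} (hu : ContDiffAt ℝ 1 u ξ) (e : Pt) :
    ContinuousAt (fun y => fderiv ℝ u y e) ξ :=
  ((hu.fderiv_right (m := 0) (by norm_num)).clm_apply contDiffAt_const).continuousAt

lemma continuousAt_lap {u : Pt → ℂ} {ξ : Pt} (hu : ContDiffAt ℝ 2 u ξ) :
    ContinuousAt (lap u) ξ :=
  (continuousAt_fderiv_apply (contDiffAt_fderiv_apply hu _) _).add
    (continuousAt_fderiv_apply (contDiffAt_fderiv_apply hu _) _)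

lemma continuousAt_wronskian {u v : Pt → ℂ} {ξ : Pt} (hu : ContDiffAt ℝ 1 u ξ)
    (hv : ContDiffAt ℝ 1 v ξ) (e : Pt) : ContinuousAt (wronskian u v e) ξ :=
  (hu.continuousAt.mul (continuousAt_fderiv_apply hv e)).sub
    (hv.continuousAt.mul (continuousAt_fderiv_apply hu e))

lemma differentiableAt_wronskian {u v : Pt → ℂ} {ξ : Pt} (hu : ContDiffAt ℝ 2 u ξ)
    (hv : ContDiffAt ℝ 2 v ξ) (e : Pt) : DifferentiableAt ℝ (wronskian u v e) ξ := by
  have h1 := hu.differentiableAt (by norm_num)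
  have h2 := hv.differentiableAt (by norm_num)
  have h3 := (contDiffAt_fderiv_apply hu e).differentiableAt (by norm_num)
  have h4 := (contDiffAt_fderiv_apply hv e).differentiableAt (by norm_num)
  exact (h1.mul h4).sub (h2.mul h3)

lemma div_wronskian {u v : Pt → ℂ} {ξ : Pt} (hu : ContDiffAt ℝ 2 u ξ)
    (hv : ContDiffAt ℝ 2 v ξ) :
    fderiv ℝ (wronskian u v (pt 1 0)) ξ (pt 1 0) + fderiv ℝ (wronskian u v (pt 0 1)) ξ (pt 0 1) =
      u ξ * lap v ξ - v ξ * lap u ξ := by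
  have h1 := hu.differentiableAt (by norm_num)
  have h2 := hv.differentiableAt (by norm_num)
  have key : ∀ e, fderiv ℝ (wronskian u v e) ξ e =
      u ξ * fderiv ℝ (fun y => fderiv ℝ v y e) ξ e -
        v ξ * fderiv ℝ (fun y => fderiv ℝ u y e) ξ e := by
    intro e
    have h3 := (contDiffAt_fderiv_apply hu e).differentiableAt (by norm_num)
    have h4 := (contDiffAt_fderiv_apply hv e).differentiableAt (by norm_num)
    have := ((h1.hasFDerivAt.mul h4.hasFDerivAt).sub (h2.hasFDerivAt.mul h3.hasFDerivAt)).fderiv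
    have h5 : fderiv ℝ (wronskian u v e) ξ = _ := this
    rw [h5]
    simp only [sub_apply, add_apply, smul_apply, smul_eq_mul]
    ring
  rw [key, key, lap, lap]
  ring

lemma eventuallyEq_zero_of_notMem_tsupport {χ : Pt → ℂ} {ξ : Pt} (h : ξ ∉ tsupport χ) :
    χ =ᶠ[𝓝 ξ] 0 := notMem_tsupport_iff_eventuallyEq.1 h

lemma lap_eq_zero_of_eventuallyEq_zero {χ : Pt → ℂ} {ξ : Pt} (h : χ =ᶠ[𝓝 ξ] 0) :
    lap χ ξ = 0 := by
  have hd : ∀ e, (fun y => fderiv ℝ χ y e) =ᶠ[𝓝 ξ] fun _ => 0 := by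
    intro e
    filter_upwards [h.fderiv (𝕜 := ℝ)] with y hy
    rw [hy]; simp
  simp [lap, (hd _).fderiv_eq]

lemma tsupport_lap_subset (χ : Pt → ℂ) : tsupport (lap χ) ⊆ tsupport χ := by
  refine closure_minimal (fun ξ hξ => ?_) (isClosed_tsupport χ)
  by_contra h
  exact hξ (lap_eq_zero_of_eventuallyEq_zero (eventuallyEq_zero_of_notMem_tsupport h))

/-- A `C²` function that solves the Helmholtz equation weakly on an open set solves it
pointwise. -/
lemma helmholtz_of_weak {O : Set Pt} (hO : IsOpen O) {w : Pt → ℂ} (hw : ContDiffOn ℝ 2 w O)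
    (k : ℂ)
    (hweak : ∀ φ : Pt → ℂ, ContDiff ℝ (⊤ : ℕ∞) φ → HasCompactSupport φ → tsupport φ ⊆ O →
      ∫ ξ, w ξ * (lap φ ξ + k ^ 2 * φ ξ) = 0) :
    ∀ ξ ∈ O, lap w ξ + k ^ 2 * w ξ = 0 := by
  have hwA : ∀ ξ ∈ O, ContDiffAt ℝ 2 w ξ := fun ξ hξ => hw.contDiffAt (hO.mem_nhds hξ)
  have hcont : ContinuousOn (fun ξ => lap w ξ + k ^ 2 * w ξ) O := fun ξ hξ =>
    ((continuousAt_lap (hwA ξ hξ)).add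
      (continuousAt_const.mul (hwA ξ hξ).continuousAt)).continuousWithinAt
  have hae : ∀ᵐ ξ : Pt, ξ ∈ O → lap w ξ + k ^ 2 * w ξ = 0 := by
    refine hO.ae_eq_zero_of_integral_contDiff_smul_eq_zero
      (hcont.locallyIntegrableOn hO.measurableSet) fun g hg hgs hgO => ?_
    set φ : Pt → ℂ := fun ξ => (g ξ : ℂ) with hφ
    have hφc : ContDiff ℝ (⊤ : ℕ∞) φ := Complex.ofRealCLM.contDiff.comp hg
    have hφ2 : ∀ ξ, ContDiffAt ℝ 2 φ ξ := fun ξ => (contDiff_infty.1 hφc 2).contDiffAt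
    have hφs : HasCompactSupport φ := hgs.comp_left Complex.ofReal_zero
    have hφO : tsupport φ ⊆ O := (tsupport_comp_subset Complex.ofReal_zero g).trans hgO
    have hzero : ∀ ξ, ξ ∉ tsupport φ → ∀ e, wronskian w φ e =ᶠ[𝓝 ξ] 0 := by
      intro ξ hξ e
      have h := eventuallyEq_zero_of_notMem_tsupport hξ
      filter_upwards [h, h.fderiv (𝕜 := ℝ)] with y hy hy'
      simp [wronskian, hy, hy']
    have hts : ∀ e, tsupport (wronskian w φ e) ⊆ tsupport φ := fun e ξ hξ => by
      by_contra h
      exact notMem_tsupport_iff_eventuallyEq.2 (hzero ξ h e) hξ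
    have hwc : ∀ e, Continuous (wronskian w φ e) := fun e =>
      continuous_of_tsupport fun ξ hξ =>
        continuousAt_wronskian ((hwA ξ (hφO (hts e hξ))).of_le (by norm_num))
          ((hφ2 ξ).of_le (by norm_num)) e
    have hws : ∀ e, HasCompactSupport (wronskian w φ e) := fun e =>
      hφs.isCompact.of_isClosed_subset (isClosed_tsupport _) (hts e)
    have hwd : ∀ e ξ, DifferentiableAt ℝ (wronskian w φ e) ξ := by
      intro e ξ
      by_cases h : ξ ∈ tsupport φ
      · exact differentiableAt_wronskian (hwA ξ (hφO h)) (hφ2 ξ) e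
      · exact (hzero ξ h e).differentiableAt_iff.2 (differentiableAt_const _)
    have hts1 : tsupport (fun ξ => w ξ * lap φ ξ) ⊆ tsupport φ :=
      tsupport_mul_subset_right.trans (tsupport_lap_subset φ)
    have hts2 : tsupport (fun ξ => φ ξ * lap w ξ) ⊆ tsupport φ := tsupport_mul_subset_left
    have hts3 : tsupport (fun ξ => w ξ * φ ξ) ⊆ tsupport φ := tsupport_mul_subset_right
    have c1 : Continuous fun ξ => w ξ * lap φ ξ := continuous_of_tsupport fun ξ hξ =>
      (hwA ξ (hφO (hts1 hξ))).continuousAt.mul (continuousAt_lap (hφ2 ξ))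
    have c2 : Continuous fun ξ => φ ξ * lap w ξ := continuous_of_tsupport fun ξ hξ =>
      (hφ2 ξ).continuousAt.mul (continuousAt_lap (hwA ξ (hφO (hts2 hξ))))
    have c3 : Continuous fun ξ => w ξ * φ ξ := continuous_of_tsupport fun ξ hξ =>
      (hwA ξ (hφO (hts3 hξ))).continuousAt.mul (hφ2 ξ).continuousAt
    have s1 := hφs.isCompact.of_isClosed_subset (isClosed_tsupport _) hts1
    have s2 := hφs.isCompact.of_isClosed_subset (isClosed_tsupport _) hts2
    have s3 := hφs.isCompact.of_isClosed_subset (isClosed_tsupport _) hts3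
    have i1 : Integrable fun ξ => w ξ * lap φ ξ := c1.integrable_of_hasCompactSupport s1
    have i2 : Integrable fun ξ => φ ξ * lap w ξ := c2.integrable_of_hasCompactSupport s2
    have i3 : Integrable fun ξ => w ξ * φ ξ := c3.integrable_of_hasCompactSupport s3
    have green := integral_divergence_eq_zero (hwc (pt 1 0)) (hwc (pt 0 1)) (c1.sub c2)
      (hws _) (hws _) (HasCompactSupport.sub (f := fun ξ => w ξ * lap φ ξ) s1 s2)
      (fun ξ _ => hwd _ ξ) (fun ξ _ => hwd _ ξ) (fun ξ _ => ?_)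
    · have h1 : (fun ξ => g ξ • (lap w ξ + k ^ 2 * w ξ)) = fun ξ =>
          w ξ * (lap φ ξ + k ^ 2 * φ ξ) - (w ξ * lap φ ξ - φ ξ * lap w ξ) := by
        funext ξ
        simp only [hφ, Complex.real_smul]
        ring
      have i4 : Integrable fun ξ => w ξ * (lap φ ξ + k ^ 2 * φ ξ) := by
        refine (i1.add (i3.const_mul (k ^ 2))).congr (.of_forall fun ξ => ?_)
        simp only [Pi.add_apply]
        ring
      have h2 := integral_sub i4 (i1.sub i2)
      rw [hweak φ hφc hφs hφO, green, sub_zero] at h2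
      rw [h1]
      exact h2
    · by_cases h : ξ ∈ tsupport φ
      · exact (div_wronskian (hwA ξ (hφO h)) (hφ2 ξ)).symm
      · have h0 := eventuallyEq_zero_of_notMem_tsupport h
        simp [(hzero ξ h _).fderiv_eq, lap_eq_zero_of_eventuallyEq_zero h0, h0.eq_of_nhds]
  have := Measure.eqOn_open_of_ae_eq (μ := (volume : Measure Pt))
    (g := fun _ => 0) ((ae_restrict_iff' hO.measurableSet).2 hae) hO hcont continuousOn_const
  exact fun ξ hξ => this hξ

/-- A function behaving like a fundamental solution with source `y`, in the pointwise sense. -/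
structure PointwiseSource (κ1 κ2 : ℝ) (w : Pt → ℂ) (y : Pt) : Prop where
  reg : SourceRegular w y
  sing : HasLogSingularity w y
  helmholtz : ∀ ξ : Pt, ξ 1 ≠ 0 → ξ ≠ y →
    lap w ξ + ((kappa0 κ1 κ2 ξ : ℝ) : ℂ) ^ 2 * w ξ = 0

lemma isOpen_upper_diff (y : Pt) : IsOpen ({ξ : Pt | 0 < ξ 1} \ {y}) :=
  (isOpen_lt continuous_const (by fun_prop)).sdiff isClosed_singleton

lemma isOpen_lower_diff (y : Pt) : IsOpen ({ξ : Pt | ξ 1 < 0} \ {y}) :=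
  (isOpen_lt (by fun_prop) continuous_const).sdiff isClosed_singleton

lemma SourceRegular.contDiffAt_two {w : Pt → ℂ} {y ξ : Pt} (h : SourceRegular w y)
    (h1 : ξ 1 ≠ 0) (hy : ξ ≠ y) : ContDiffAt ℝ 2 w ξ := by
  rcases lt_or_gt_of_ne h1 with h0 | h0
  · exact h.2.2.contDiffAt ((isOpen_lower_diff y).mem_nhds ⟨h0, hy⟩)
  · exact h.2.1.contDiffAt ((isOpen_upper_diff y).mem_nhds ⟨h0, hy⟩)

lemma SourceRegular.contDiffAt_one {w : Pt → ℂ} {y ξ : Pt} (h : SourceRegular w y)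
    (hy : ξ ≠ y) : ContDiffAt ℝ 1 w ξ :=
  h.1.contDiffAt (isOpen_compl_singleton.mem_nhds hy)

lemma IsPointSourceSol.pointwiseSource {κ1 κ2 : ℝ} {w : Pt → ℂ} {y : Pt}
    (hsol : IsPointSourceSol κ1 κ2 w y) (hreg : SourceRegular w y)
    (hsing : HasLogSingularity w y) : PointwiseSource κ1 κ2 w y := by
  have aux : ∀ O : Set Pt, IsOpen O → y ∉ O → ContDiffOn ℝ 2 w O → ∀ k : ℝ,
      (∀ ξ ∈ O, kappa0 κ1 κ2 ξ = k) → ∀ ξ ∈ O, lap w ξ + (k : ℂ) ^ 2 * w ξ = 0 := by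
    intro O hO hyO hw k hk
    refine helmholtz_of_weak hO hw k fun φ hφ hφs hφO => ?_
    have h := hsol φ hφ hφs
    rw [image_eq_zero_of_notMem_tsupport fun h' => hyO (hφO h'), neg_zero] at h
    rw [← h]
    refine integral_congr_ae (.of_forall fun ξ => ?_)
    by_cases hξ : ξ ∈ tsupport φ
    · simp only [hk ξ (hφO hξ)]
    · simp [image_eq_zero_of_notMem_tsupport hξ]
  refine ⟨hreg, hsing, fun ξ h1 hy => ?_⟩
  rcases lt_or_gt_of_ne h1 with h0 | h0
  · have hk : ∀ ζ ∈ {ζ : Pt | ζ 1 < 0} \ {y}, kappa0 κ1 κ2 ζ = κ2 := fun ζ hζ =>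
      if_neg (not_lt.2 (le_of_lt hζ.1))
    have hm : ξ ∈ {ζ : Pt | ζ 1 < 0} \ {y} := ⟨h0, hy⟩
    rw [hk ξ hm]
    exact aux _ (isOpen_lower_diff y) (by simp) hreg.2.2 κ2 hk ξ hm
  · have hk : ∀ ζ ∈ {ζ : Pt | 0 < ζ 1} \ {y}, kappa0 κ1 κ2 ζ = κ1 := fun ζ hζ => if_pos hζ.1
    have hm : ξ ∈ {ζ : Pt | 0 < ζ 1} \ {y} := ⟨h0, hy⟩
    rw [hk ξ hm]
    exact aux _ (isOpen_upper_diff y) (by simp) hreg.2.1 κ1 hk ξ hm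

lemma fderiv_conj_apply (u : Pt → ℂ) (ξ e : Pt) :
    fderiv ℝ (fun y => starRingEnd ℂ (u y)) ξ e = starRingEnd ℂ (fderiv ℝ u ξ e) := by
  have := Complex.conjCLE.comp_fderiv (f := u) (x := ξ)
  have h2 := congrArg (fun L : Pt →L[ℝ] ℂ => L e) this
  simpa [Function.comp_def] using h2

lemma PointwiseSource.conj {κ1 κ2 : ℝ} {w : Pt → ℂ} {y : Pt} (h : PointwiseSource κ1 κ2 w y) :
    PointwiseSource κ1 κ2 (fun ξ => starRingEnd ℂ (w ξ)) y := by
  have hc : ∀ {n : WithTop ℕ∞} {f : Pt → ℂ} {s : Set Pt}, ContDiffOn ℝ n f s →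
      ContDiffOn ℝ n (fun ξ => starRingEnd ℂ (f ξ)) s := fun hf =>
    Complex.conjCLE.contDiff.comp_contDiffOn hf
  refine ⟨⟨hc h.reg.1, hc h.reg.2.1, hc h.reg.2.2⟩, ?_, fun ξ h1 hy => ?_⟩
  · obtain ⟨U, hU, hyU, g, hg, hw⟩ := h.sing
    refine ⟨U, hU, hyU, _, hc hg, fun ξ hξ => ?_⟩
    simp only [hw ξ hξ, map_add, map_mul, map_neg, Complex.conj_ofReal]
  · have := congrArg (starRingEnd ℂ) (h.helmholtz ξ h1 hy)
    simp only [map_add, map_mul, map_pow, Complex.conj_ofReal, map_zero, lap] at this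
    simp only [lap, fderiv_conj_apply]
    exact this

/-- The field `u ∇v - v ∇u` of two point sources is weakly divergence free off the sources. -/
lemma integral_grad_wronskian_eq_zero {κ1 κ2 : ℝ} {u v : Pt → ℂ} {x z : Pt}
    (hu : PointwiseSource κ1 κ2 u x) (hv : PointwiseSource κ1 κ2 v z) {χ : Pt → ℂ}
    (hχ : ContDiff ℝ 1 χ) (hχs : HasCompactSupport χ) (hx : x ∉ tsupport χ)
    (hz : z ∉ tsupport χ) :
    ∫ ξ, (fderiv ℝ χ ξ (pt 1 0) * wronskian u v (pt 1 0) ξ +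
      fderiv ℝ χ ξ (pt 0 1) * wronskian u v (pt 0 1) ξ) = 0 := by
  have hne : ∀ ξ ∈ tsupport χ, ξ ≠ x ∧ ξ ≠ z := fun ξ hξ =>
    ⟨fun h => hx (h ▸ hξ), fun h => hz (h ▸ hξ)⟩
  have hWc : ∀ e, ∀ ξ ∈ tsupport χ, ContinuousAt (wronskian u v e) ξ := fun e ξ hξ =>
    continuousAt_wronskian (hu.reg.contDiffAt_one (hne ξ hξ).1)
      (hv.reg.contDiffAt_one (hne ξ hξ).2) e
  have tsub : ∀ e, tsupport (fun ξ => χ ξ * wronskian u v e ξ) ⊆ tsupport χ := fun e =>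
    tsupport_mul_subset_left
  have tsub' : ∀ e, tsupport (fun ξ => fderiv ℝ χ ξ e * wronskian u v e ξ) ⊆ tsupport χ :=
    fun e => tsupport_mul_subset_left.trans (tsupport_fderiv_apply_subset ℝ e)
  have c1 : ∀ e, Continuous fun ξ => χ ξ * wronskian u v e ξ := fun e =>
    continuous_of_tsupport fun ξ hξ =>
      hχ.continuous.continuousAt.mul (hWc e ξ (tsub e hξ))
  have c2 : ∀ e, Continuous fun ξ => fderiv ℝ χ ξ e * wronskian u v e ξ := fun e =>
    continuous_of_tsupport fun ξ hξ =>
      (continuousAt_fderiv_apply hχ.contDiffAt e).mul (hWc e ξ (tsub' e hξ))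
  have s1 : ∀ e, HasCompactSupport fun ξ => χ ξ * wronskian u v e ξ := fun e =>
    hχs.isCompact.of_isClosed_subset (isClosed_tsupport _) (tsub e)
  have s2 : ∀ e, HasCompactSupport fun ξ => fderiv ℝ χ ξ e * wronskian u v e ξ := fun e =>
    hχs.isCompact.of_isClosed_subset (isClosed_tsupport _) (tsub' e)
  have hzero : ∀ ξ, ξ ∉ tsupport χ → ∀ e, (fun ξ => χ ξ * wronskian u v e ξ) =ᶠ[𝓝 ξ] 0 := by
    intro ξ hξ e
    filter_upwards [eventuallyEq_zero_of_notMem_tsupport hξ] with y hy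
    simp [hy]
  have hWd : ∀ e ξ, ξ ∈ tsupport χ → ξ 1 ≠ 0 → DifferentiableAt ℝ (wronskian u v e) ξ :=
    fun e ξ hξ h1 => differentiableAt_wronskian (hu.reg.contDiffAt_two h1 (hne ξ hξ).1)
      (hv.reg.contDiffAt_two h1 (hne ξ hξ).2) e
  have hχd : ∀ ξ, DifferentiableAt ℝ χ ξ := fun ξ => hχ.differentiable (by norm_num) ξ
  have hd : ∀ e ξ, ξ 1 ≠ 0 → DifferentiableAt ℝ (fun ξ => χ ξ * wronskian u v e ξ) ξ := by
    intro e ξ h1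
    by_cases h : ξ ∈ tsupport χ
    · exact (hχd ξ).mul (hWd e ξ h h1)
    · exact (hzero ξ h e).differentiableAt_iff.2 (differentiableAt_const _)
  refine integral_divergence_eq_zero (c1 (pt 1 0)) (c1 (pt 0 1)) ((c2 _).add (c2 _)) (s1 _) (s1 _)
    (HasCompactSupport.add (s2 _) (s2 _)) (hd _) (hd _) fun ξ h1 => ?_
  by_cases h : ξ ∈ tsupport χ
  · have hu2 := hu.reg.contDiffAt_two h1 (hne ξ h).1
    have hv2 := hv.reg.contDiffAt_two h1 (hne ξ h).2
    have hdiv := div_wronskian hu2 hv2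
    have e1 := hu.helmholtz ξ h1 (hne ξ h).1
    have e2 := hv.helmholtz ξ h1 (hne ξ h).2
    have hprod : ∀ e, fderiv ℝ (fun ξ => χ ξ * wronskian u v e ξ) ξ e =
        χ ξ * fderiv ℝ (wronskian u v e) ξ e + wronskian u v e ξ * fderiv ℝ χ ξ e := fun e => by
      rw [((hχd ξ).hasFDerivAt.fun_mul (hWd e ξ h h1).hasFDerivAt).fderiv]
      simp
    rw [hprod, hprod]
    linear_combination (-χ ξ) * hdiv + (-χ ξ) * (u ξ * e2 - v ξ * e1)
  · have h0 := eventuallyEq_zero_of_notMem_tsupport h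
    simp [(hzero ξ h _).fderiv_eq, h0.fderiv_eq]

lemma norm_ptc {r : ℝ} (hr : 0 ≤ r) (θ : ℝ) : ‖ptc r θ‖ = r := by
  refine (sq_eq_sq₀ (norm_nonneg _) hr).1 ?_
  rw [ptc, norm_pt_sq]
  nlinarith [sin_sq_add_cos_sq θ]

lemma continuous_ptc : Continuous fun p : ℝ × ℝ => ptc p.1 p.2 := by
  have : (fun p : ℝ × ℝ => ptc p.1 p.2) =
      fun p : ℝ × ℝ => ptL (p.1 * cos p.2, p.1 * sin p.2) := by
    funext p; rw [ptL_apply]; rfl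
  rw [this]
  fun_prop

/-- The radial profile of `cutoff`. -/
def cutoffProfile (a b r : ℝ) : ℝ := smoothTransition ((b ^ 2 - r ^ 2) / (b ^ 2 - a ^ 2))

/-- A smooth radial function around `c` equal to `1` for radius at most `a` and `0` for radius at
least `b`. -/
def cutoff (c : Pt) (a b : ℝ) (ξ : Pt) : ℂ := (cutoffProfile a b ‖ξ - c‖ : ℂ)

/-- Minus the radial derivative of `cutoff`. -/
def cutoffDensity (a b r : ℝ) : ℝ :=
  deriv smoothTransition ((b ^ 2 - r ^ 2) / (b ^ 2 - a ^ 2)) * (2 * r / (b ^ 2 - a ^ 2))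

lemma cutoff_eq_one {a b : ℝ} (ha : 0 < a) (hab : a < b) (c : Pt) {ξ : Pt} (h : ‖ξ - c‖ ≤ a) :
    cutoff c a b ξ = 1 := by
  have hpos : 0 < b ^ 2 - a ^ 2 := by nlinarith
  rw [cutoff, cutoffProfile, smoothTransition.one_of_one_le, Complex.ofReal_one]
  rw [le_div_iff₀ hpos]
  nlinarith [norm_nonneg (ξ - c)]

lemma cutoff_eq_zero {a b : ℝ} (ha : 0 < a) (hab : a < b) (c : Pt) {ξ : Pt} (h : b ≤ ‖ξ - c‖) :
    cutoff c a b ξ = 0 := by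
  have hpos : 0 < b ^ 2 - a ^ 2 := by nlinarith
  rw [cutoff, cutoffProfile, smoothTransition.zero_of_nonpos, Complex.ofReal_zero]
  exact div_nonpos_of_nonpos_of_nonneg (by nlinarith) hpos.le

lemma contDiff_cutoff {a b : ℝ} (c : Pt) : ContDiff ℝ 1 (cutoff c a b) := by
  have h1 : ContDiff ℝ 1 fun ξ : Pt => (b ^ 2 - ‖ξ - c‖ ^ 2) / (b ^ 2 - a ^ 2) :=
    (contDiff_const.sub ((contDiff_id.sub contDiff_const).norm_sq ℝ)).div_const _
  exact Complex.ofRealCLM.contDiff.comp ((smoothTransition.contDiff (n := 1)).comp h1)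

lemma hasCompactSupport_cutoff {a b : ℝ} (ha : 0 < a) (hab : a < b) (c : Pt) :
    HasCompactSupport (cutoff c a b) :=
  HasCompactSupport.intro (isCompact_closedBall c b) fun ξ hξ =>
    cutoff_eq_zero ha hab c (by
      rw [Metric.mem_closedBall, dist_eq_norm, not_le] at hξ; exact hξ.le)

lemma hasDerivAt_smoothTransition (s : ℝ) :
    HasDerivAt smoothTransition (deriv smoothTransition s) s :=
  ((smoothTransition.contDiff (n := 1)).differentiable (by norm_num) s).hasDerivAt

lemma fderiv_cutoff {a b : ℝ} (c : Pt) (ξ e : Pt) : fderiv ℝ (cutoff c a b) ξ e =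
    ((deriv smoothTransition ((b ^ 2 - ‖ξ - c‖ ^ 2) / (b ^ 2 - a ^ 2)) *
      (-2 / (b ^ 2 - a ^ 2) * inner ℝ (ξ - c) e) : ℝ) : ℂ) := by
  have h1 : HasFDerivAt (fun ξ : Pt => ‖ξ - c‖ ^ 2) _ ξ :=
    ((hasFDerivAt_id ξ).sub_const c).norm_sq
  have h2 := ((h1.const_sub (b ^ 2)).mul_const (b ^ 2 - a ^ 2)⁻¹)
  have h3 := (hasDerivAt_smoothTransition
    ((b ^ 2 - ‖ξ - c‖ ^ 2) * (b ^ 2 - a ^ 2)⁻¹)).comp_hasFDerivAt ξ h2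
  have h4 : HasFDerivAt (cutoff c a b) _ ξ := Complex.ofRealCLM.hasFDerivAt.comp ξ h3
  rw [h4.fderiv]
  simp only [ContinuousLinearMap.comp_apply, smul_apply, neg_apply, innerSL_apply_apply,
    ContinuousLinearMap.id_apply, id_eq, Complex.ofRealCLM_apply, smul_eq_mul, nsmul_eq_mul,
    div_eq_mul_inv]
  push_cast
  ring

lemma deriv_smoothTransition_eq_zero {a b : ℝ} (ha : 0 < a) (hab : a < b) {r : ℝ}
    (hr : 0 ≤ r) (h : r < a ∨ b < r) :
    deriv smoothTransition ((b ^ 2 - r ^ 2) / (b ^ 2 - a ^ 2)) = 0 := by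
  have hpos : 0 < b ^ 2 - a ^ 2 := by nlinarith
  rcases h with h | h
  · have h1 : 1 < (b ^ 2 - r ^ 2) / (b ^ 2 - a ^ 2) := by
      rw [lt_div_iff₀ hpos]; nlinarith
    have : smoothTransition =ᶠ[𝓝 ((b ^ 2 - r ^ 2) / (b ^ 2 - a ^ 2))] fun _ => 1 := by
      filter_upwards [lt_mem_nhds h1] with s hs using smoothTransition.one_of_one_le hs.le
    rw [this.deriv_eq, deriv_const]
  · have h1 : (b ^ 2 - r ^ 2) / (b ^ 2 - a ^ 2) < 0 :=
      div_neg_of_neg_of_pos (by nlinarith) hpos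
    have : smoothTransition =ᶠ[𝓝 ((b ^ 2 - r ^ 2) / (b ^ 2 - a ^ 2))] fun _ => 0 := by
      filter_upwards [gt_mem_nhds h1] with s hs using smoothTransition.zero_of_nonpos hs.le
    rw [this.deriv_eq, deriv_const]

lemma cutoffDensity_nonneg {a b : ℝ} (ha : 0 < a) (hab : a < b) {r : ℝ} (hr : 0 ≤ r) :
    0 ≤ cutoffDensity a b r := by
  have hpos : 0 < b ^ 2 - a ^ 2 := by nlinarith
  have : 0 ≤ deriv smoothTransition ((b ^ 2 - r ^ 2) / (b ^ 2 - a ^ 2)) :=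
    smoothTransition.monotone.deriv_nonneg
  rw [cutoffDensity]
  positivity

lemma hasDerivAt_cutoffProfile (a b r : ℝ) :
    HasDerivAt (cutoffProfile a b) (-cutoffDensity a b r) r := by
  have h1 := ((hasDerivAt_pow 2 r).const_sub (b ^ 2)).div_const (b ^ 2 - a ^ 2)
  have h2 := (hasDerivAt_smoothTransition ((b ^ 2 - r ^ 2) / (b ^ 2 - a ^ 2))).comp r h1
  refine h2.congr_deriv ?_
  simp [cutoffDensity]
  ring

lemma tendsto_cutoffProfile {a b : ℝ} (ha : 0 < a) (hab : a < b) :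
    Tendsto (cutoffProfile a b) atTop (𝓝 0) := by
  have hpos : 0 < b ^ 2 - a ^ 2 := by nlinarith
  refine tendsto_const_nhds.congr' ?_
  filter_upwards [eventually_ge_atTop b] with r hr
  exact (smoothTransition.zero_of_nonpos
    (div_nonpos_of_nonpos_of_nonneg (by nlinarith) hpos.le)).symm

lemma integrableOn_cutoffDensity {a b : ℝ} (ha : 0 < a) (hab : a < b) :
    IntegrableOn (cutoffDensity a b) (Set.Ioi 0) := by
  have := integrableOn_Ioi_deriv_of_nonpos' (a := 0)
    (fun r _ => hasDerivAt_cutoffProfile a b r)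
    (fun r hr => neg_nonpos.2 (cutoffDensity_nonneg ha hab (le_of_lt hr)))
    (tendsto_cutoffProfile ha hab)
  simpa using this.neg

lemma integral_cutoffDensity {a b : ℝ} (ha : 0 < a) (hab : a < b) :
    ∫ r in Set.Ioi 0, cutoffDensity a b r = 1 := by
  have hpos : 0 < b ^ 2 - a ^ 2 := by nlinarith
  have := integral_Ioi_of_hasDerivAt_of_nonpos' (a := 0)
    (fun r _ => hasDerivAt_cutoffProfile a b r)
    (fun r hr => neg_nonpos.2 (cutoffDensity_nonneg ha hab (le_of_lt hr)))
    (tendsto_cutoffProfile ha hab)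
  have h0 : cutoffProfile a b 0 = 1 :=
    smoothTransition.one_of_one_le (by rw [le_div_iff₀ hpos]; nlinarith)
  rw [integral_neg, h0] at this
  linarith

/-- Testing a continuous field against the gradient of a radial cutoff averages its flux through
the circles of radius between `a` and `b`. -/
lemma integrable_and_norm_integral_cutoff_add_le {a b : ℝ} (ha : 0 < a) (hab : a < b)
    (c : Pt) {W1 W2 : Pt → ℂ}
    (hW1 : ∀ ξ, a ≤ ‖ξ - c‖ → ‖ξ - c‖ ≤ b → ContinuousAt W1 ξ)
    (hW2 : ∀ ξ, a ≤ ‖ξ - c‖ → ‖ξ - c‖ ≤ b → ContinuousAt W2 ξ)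
    {f0 : ℝ → ℂ} (hf0 : Continuous f0) {δ : ℝ}
    (h : ∀ r ∈ Set.Icc a b, ∀ θ ∈ Set.Icc (-π) π,
      ‖((ptc r θ 0 : ℝ) : ℂ) * W1 (c + ptc r θ) + ((ptc r θ 1 : ℝ) : ℂ) * W2 (c + ptc r θ)
        - f0 θ‖ ≤ δ) :
    Integrable (fun ξ => fderiv ℝ (cutoff c a b) ξ (pt 1 0) * W1 ξ +
      fderiv ℝ (cutoff c a b) ξ (pt 0 1) * W2 ξ) ∧
    ‖(∫ ξ, (fderiv ℝ (cutoff c a b) ξ (pt 1 0) * W1 ξ +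
      fderiv ℝ (cutoff c a b) ξ (pt 0 1) * W2 ξ)) + ∫ θ in (-π)..π, f0 θ‖ ≤ 2 * π * δ := by
  have hcl : IsClosed {ξ : Pt | a ≤ ‖ξ - c‖ ∧ ‖ξ - c‖ ≤ b} :=
    (isClosed_le (f := fun _ : Pt => a) (g := fun ξ => ‖ξ - c‖) (by fun_prop) (by fun_prop)).inter
      (isClosed_le (f := fun ξ : Pt => ‖ξ - c‖) (g := fun _ => b) (by fun_prop) (by fun_prop))
  have hts : ∀ e, tsupport (fun ξ => fderiv ℝ (cutoff c a b) ξ e) ⊆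
      {ξ | a ≤ ‖ξ - c‖ ∧ ‖ξ - c‖ ≤ b} := by
    intro e
    refine closure_minimal (fun ξ hξ => ?_) hcl
    by_contra hn
    simp only [Set.mem_ofPred_eq, not_and_or, not_le] at hn
    refine hξ ?_
    simp only [fderiv_cutoff c, deriv_smoothTransition_eq_zero ha hab (norm_nonneg _) hn]
    simp
  have hcont : ∀ (W : Pt → ℂ), (∀ ξ, a ≤ ‖ξ - c‖ → ‖ξ - c‖ ≤ b → ContinuousAt W ξ) → ∀ e,
      Continuous fun ξ => fderiv ℝ (cutoff c a b) ξ e * W ξ := fun W hW e =>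
    continuous_of_tsupport fun ξ hξ => by
      have := hts e (tsupport_mul_subset_left hξ)
      exact (continuousAt_fderiv_apply (contDiff_cutoff c).contDiffAt e).mul
        (hW ξ this.1 this.2)
  set D : Pt → ℂ := fun ξ => fderiv ℝ (cutoff c a b) ξ (pt 1 0) * W1 ξ +
      fderiv ℝ (cutoff c a b) ξ (pt 0 1) * W2 ξ with hD
  have hDc : Continuous D := (hcont W1 hW1 _).add (hcont W2 hW2 _)
  have hDs : HasCompactSupport D :=
    HasCompactSupport.intro (isCompact_closedBall c b) fun ξ hξ => by
      rw [Metric.mem_closedBall, dist_eq_norm, not_le] at hξ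
      simp [hD, fderiv_cutoff c, deriv_smoothTransition_eq_zero ha hab (norm_nonneg _) (.inr hξ)]
  refine ⟨hDc.integrable_of_hasCompactSupport hDs, ?_⟩
  have hpol : ∫ ξ, D ξ = ∫ p in polarCoord.target, p.1 • D (c + ptc p.1 p.2) := by
    rw [← integral_add_left_eq_self D c, integral_eq_integral_pt, ← integral_comp_polarCoord_symm]
    rfl
  set ψ := cutoffDensity a b with hψ
  have hval : ∀ r θ, 0 < r → r • D (c + ptc r θ) = -((ψ r : ℝ) : ℂ) *
      (((ptc r θ 0 : ℝ) : ℂ) * W1 (c + ptc r θ) + ((ptc r θ 1 : ℝ) : ℂ) * W2 (c + ptc r θ)) := by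
    intro r θ hr
    have i0 : ∀ ζ : Pt, inner ℝ ζ (pt 1 0) = ζ 0 := fun ζ => by
      simp [PiLp.inner_apply]
    have i1 : ∀ ζ : Pt, inner ℝ ζ (pt 0 1) = ζ 1 := fun ζ => by
      simp [PiLp.inner_apply]
    simp only [hD, fderiv_cutoff c, add_sub_cancel_left, norm_ptc hr.le, i0, i1, hψ, cutoffDensity,
      Complex.real_smul]
    push_cast
    ring
  have hπ : (-π) ≤ π := by linarith [pi_pos]
  have hT : polarCoord.target = Set.Ioi (0 : ℝ) ×ˢ Set.Ioo (-π) π := rfl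
  have hμ : (volume : Measure (ℝ × ℝ)).restrict polarCoord.target =
      (volume.restrict (Set.Ioi (0 : ℝ))).prod (volume.restrict (Set.Ioo (-π) π)) := by
    rw [hT, Measure.prod_restrict]; rfl
  have iψ : Integrable (fun r => ((ψ r : ℝ) : ℂ)) (volume.restrict (Set.Ioi (0 : ℝ))) :=
    (integrableOn_cutoffDensity ha hab).ofReal
  have if0 : Integrable f0 (volume.restrict (Set.Ioo (-π) π)) :=
    (hf0.continuousOn.integrableOn_compact isCompact_Icc).mono_set Set.Ioo_subset_Icc_self
  have i1 : IntegrableOn (fun p : ℝ × ℝ => ((ψ p.1 : ℝ) : ℂ) * f0 p.2) polarCoord.target := by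
    rw [IntegrableOn, hμ]
    exact iψ.mul_prod if0
  have iδ : IntegrableOn (fun p : ℝ × ℝ => ψ p.1 * δ) polarCoord.target := by
    rw [IntegrableOn, hμ]
    have : Integrable (fun _ : ℝ => δ) (volume.restrict (Set.Ioo (-π) π)) := by
      simp
    exact Integrable.mul_prod (integrableOn_cutoffDensity ha hab) this
  have v1 : ∫ p in polarCoord.target, ((ψ p.1 : ℝ) : ℂ) * f0 p.2 = ∫ θ in (-π)..π, f0 θ := by
    rw [hμ, integral_prod_mul (fun r => ((ψ r : ℝ) : ℂ)) f0, integral_complex_ofReal,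
      integral_cutoffDensity ha hab, intervalIntegral.integral_of_le hπ,
      integral_Ioc_eq_integral_Ioo]
    simp
  have vδ : ∫ p in polarCoord.target, ψ p.1 * δ = 2 * π * δ := by
    rw [hμ, integral_prod_mul ψ (fun _ => δ), integral_cutoffDensity ha hab]
    rw [one_mul, setIntegral_const, Real.volume_real_Ioo_of_le hπ, smul_eq_mul]
    ring
  have hbound : ∀ p ∈ polarCoord.target,
      ‖p.1 • D (c + ptc p.1 p.2) + ((ψ p.1 : ℝ) : ℂ) * f0 p.2‖ ≤ ψ p.1 * δ := by
    rintro ⟨r, θ⟩ ⟨hr, hθ⟩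
    have hr' : 0 < r := hr
    simp only [hval r θ hr']
    have hψ0 := cutoffDensity_nonneg ha hab hr'.le
    by_cases hrab : r ∈ Set.Icc a b
    · have := h r hrab θ (Set.Ioo_subset_Icc_self hθ)
      calc _ = ‖-((ψ r : ℝ) : ℂ) * (((ptc r θ 0 : ℝ) : ℂ) * W1 (c + ptc r θ) +
            ((ptc r θ 1 : ℝ) : ℂ) * W2 (c + ptc r θ) - f0 θ)‖ := by ring_nf
        _ = ψ r * ‖((ptc r θ 0 : ℝ) : ℂ) * W1 (c + ptc r θ) +
            ((ptc r θ 1 : ℝ) : ℂ) * W2 (c + ptc r θ) - f0 θ‖ := by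
          rw [norm_mul, norm_neg, Complex.norm_real, norm_of_nonneg hψ0]
        _ ≤ ψ r * δ := by gcongr
    · have : ψ r = 0 := by
        rw [Set.mem_Icc, not_and_or, not_le, not_le] at hrab
        rw [hψ, cutoffDensity, deriv_smoothTransition_eq_zero ha hab hr'.le hrab, zero_mul]
      simp [this]
  have hptc := continuous_ptc
  have hmT : MeasurableSet polarCoord.target := measurableSet_Ioi.prod measurableSet_Ioo
  have hmeas : Continuous fun p : ℝ × ℝ => p.1 • D (c + ptc p.1 p.2) := by fun_prop
  have iD' : IntegrableOn (fun p : ℝ × ℝ =>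
      p.1 • D (c + ptc p.1 p.2) + ((ψ p.1 : ℝ) : ℂ) * f0 p.2) polarCoord.target :=
    iδ.mono' (hmeas.aestronglyMeasurable.add i1.aestronglyMeasurable)
      ((ae_restrict_iff' hmT).2 (.of_forall hbound))
  have iD : IntegrableOn (fun p : ℝ × ℝ => p.1 • D (c + ptc p.1 p.2)) polarCoord.target := by
    refine (iD'.sub i1).congr (.of_forall fun p => ?_)
    simp
  rw [hpol, ← v1, ← integral_add iD i1, ← vδ]
  exact norm_integral_le_of_norm_le iδ ((ae_restrict_iff' hmT).2 (.of_forall hbound))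

lemma hasFDerivAt_log_norm_sub {ξ z : Pt} (h : ξ ≠ z) :
    HasFDerivAt (fun y : Pt => ((Real.log ‖y - z‖ : ℝ) : ℂ))
      (fderiv ℝ (fun y : Pt => ((Real.log ‖y - z‖ : ℝ) : ℂ)) ξ) ξ ∧
    fderiv ℝ (fun y : Pt => ((Real.log ‖y - z‖ : ℝ) : ℂ)) ξ (ξ - z) = 1 := by
  have hne : ‖ξ - z‖ ≠ 0 := norm_ne_zero_iff.2 (sub_ne_zero.2 h)
  have h1 : HasFDerivAt (fun y : Pt => ‖y - z‖ ^ 2) _ ξ :=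
    ((hasFDerivAt_id ξ).sub_const z).norm_sq
  have h2 := (h1.log (pow_ne_zero 2 hne)).const_mul (1 / 2)
  have h3 : HasFDerivAt (fun y : Pt => ((1 / 2 * Real.log (‖y - z‖ ^ 2) : ℝ) : ℂ)) _ ξ :=
    Complex.ofRealCLM.hasFDerivAt.comp ξ h2
  have heq : (fun y : Pt => ((1 / 2 * Real.log (‖y - z‖ ^ 2) : ℝ) : ℂ)) =
      fun y : Pt => ((Real.log ‖y - z‖ : ℝ) : ℂ) := by
    funext y
    rw [Real.log_pow]
    push_cast
    ring
  rw [heq] at h3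
  refine ⟨h3.differentiableAt.hasFDerivAt, ?_⟩
  rw [h3.fderiv]
  simp only [ContinuousLinearMap.comp_apply, smul_apply, innerSL_apply_apply,
    ContinuousLinearMap.id_apply, id_eq, Complex.ofRealCLM_apply, smul_eq_mul, nsmul_eq_mul,
    real_inner_self_eq_norm_sq]
  norm_cast
  field_simp

/-- The flux density of `u ∇v - v ∇u` out of a logarithmic singularity of `v`. -/
lemma tendsto_flux_of_hasLogSingularity {u v : Pt → ℂ} {z : Pt} (hu : ContDiffAt ℝ 1 u z)
    (hv : HasLogSingularity v z) :
    Tendsto (fun ξ => u ξ * fderiv ℝ v ξ (ξ - z) - v ξ * fderiv ℝ u ξ (ξ - z)) (𝓝[≠] z)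
      (𝓝 (-((1 / (2 * π) : ℝ) : ℂ) * u z)) := by
  obtain ⟨U, hU, hzU, h, hh, hvU⟩ := hv
  set k : ℂ := -((1 / (2 * π) : ℝ) : ℂ) with hk
  have hhz : ContDiffAt ℝ 1 h z := hh.contDiffAt (hU.mem_nhds hzU)
  have hd : ∀ {f : Pt → ℂ}, ContDiffAt ℝ 1 f z → ContinuousAt (fderiv ℝ f) z := fun hf =>
    (hf.fderiv_right (m := 0) (by norm_num)).continuousAt
  have ht : ContinuousAt (fun ξ : Pt => ξ - z) z := by fun_prop
  have l1 : Tendsto (fun ξ => fderiv ℝ h ξ (ξ - z)) (𝓝 z) (𝓝 0) := by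
    simpa using ((hd hhz).clm_apply ht).tendsto
  have l2 : Tendsto (fun ξ => fderiv ℝ u ξ (ξ - z)) (𝓝 z) (𝓝 0) := by
    simpa using ((hd hu).clm_apply ht).tendsto
  have l3 : Tendsto (fun ξ => ((Real.log ‖ξ - z‖ : ℝ) : ℂ) * fderiv ℝ u ξ (ξ - z)) (𝓝 z)
      (𝓝 0) := by
    refine squeeze_zero_norm (a := fun ξ => |‖ξ - z‖ * Real.log ‖ξ - z‖| * ‖fderiv ℝ u ξ‖)
      (fun ξ => ?_) ?_
    · rw [norm_mul, Complex.norm_real, abs_mul, abs_norm, Real.norm_eq_abs]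
      calc _ ≤ |Real.log ‖ξ - z‖| * (‖fderiv ℝ u ξ‖ * ‖ξ - z‖) := by
            gcongr; exact ContinuousLinearMap.le_opNorm _ _
        _ = _ := by ring
    · have c1 : ContinuousAt (fun ξ : Pt => ‖ξ - z‖ * Real.log ‖ξ - z‖) z :=
        (Real.continuous_mul_log.comp (g := fun r : ℝ => r * Real.log r)
          (f := fun ξ : Pt => ‖ξ - z‖) (by fun_prop)).continuousAt
      simpa using (c1.abs.fun_mul (hd hu).norm).tendsto
  have l4 : Tendsto (fun ξ => u ξ * (k + fderiv ℝ h ξ (ξ - z)) -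
      (k * (((Real.log ‖ξ - z‖ : ℝ) : ℂ) * fderiv ℝ u ξ (ξ - z)) +
        h ξ * fderiv ℝ u ξ (ξ - z))) (𝓝 z) (𝓝 (k * u z)) := by
    have := (hu.continuousAt.tendsto.mul (l1.const_add k)).sub
      ((l3.const_mul k).add (hhz.continuousAt.tendsto.mul l2))
    simpa [mul_comm] using this
  refine (l4.mono_left nhdsWithin_le_nhds).congr' ?_
  filter_upwards [self_mem_nhdsWithin, mem_nhdsWithin_of_mem_nhds (hU.mem_nhds hzU)] with ξ hξ hξU
  have hev : v =ᶠ[𝓝 ξ] fun y => k * ((Real.log ‖y - z‖ : ℝ) : ℂ) + h y := by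
    filter_upwards [(hU.sdiff isClosed_singleton).mem_nhds ⟨hξU, hξ⟩] with y hy
    exact hvU y hy
  obtain ⟨g1, g2⟩ := hasFDerivAt_log_norm_sub hξ
  have g3 : HasFDerivAt h (fderiv ℝ h ξ) ξ :=
    ((hh.contDiffAt (hU.mem_nhds hξU)).differentiableAt (by norm_num)).hasFDerivAt
  have g4 : fderiv ℝ v ξ (ξ - z) = k + fderiv ℝ h ξ (ξ - z) := by
    rw [hev.fderiv_eq, ((g1.const_mul k).fun_add g3).fderiv]
    simp [g2]
  rw [g4, hev.eq_of_nhds]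
  ring

lemma wronskian_radial (u v : Pt → ℂ) (η ξ : Pt) :
    ((η 0 : ℝ) : ℂ) * wronskian u v (pt 1 0) ξ + ((η 1 : ℝ) : ℂ) * wronskian u v (pt 0 1) ξ =
      u ξ * fderiv ℝ v ξ η - v ξ * fderiv ℝ u ξ η := by
  rw [clm_eq_coord (fderiv ℝ v ξ) η, clm_eq_coord (fderiv ℝ u ξ) η, wronskian, wronskian]
  ring

/-- The gradient of a cutoff paired with the field `u ∇v - v ∇u`. -/
def cutoffFlux (u v : Pt → ℂ) (c : Pt) (a b : ℝ) (ξ : Pt) : ℂ :=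
  fderiv ℝ (cutoff c a b) ξ (pt 1 0) * wronskian u v (pt 1 0) ξ +
    fderiv ℝ (cutoff c a b) ξ (pt 0 1) * wronskian u v (pt 0 1) ξ

/-- The flux density of `u ∇v - v ∇u` through circles around the origin. -/
def radialFlux (u v : Pt → ℂ) (ξ : Pt) : ℂ := u ξ * fderiv ℝ v ξ ξ - v ξ * fderiv ℝ u ξ ξ

lemma cutoffFlux_swap (u v : Pt → ℂ) (c : Pt) (a b : ℝ) (ξ : Pt) :
    cutoffFlux v u c a b ξ = -cutoffFlux u v c a b ξ := by
  simp only [cutoffFlux, wronskian]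
  ring

lemma PointwiseSource.continuousAt_wronskian {κ1 κ2 : ℝ} {u v : Pt → ℂ} {x z ξ : Pt}
    (hu : PointwiseSource κ1 κ2 u x) (hv : PointwiseSource κ1 κ2 v z) (hx : ξ ≠ x) (hz : ξ ≠ z)
    (e : Pt) : ContinuousAt (wronskian u v e) ξ :=
  _root_.continuousAt_wronskian (hu.reg.contDiffAt_one hx) (hv.reg.contDiffAt_one hz) e

lemma PointwiseSource.continuousAt_radialFlux {κ1 κ2 : ℝ} {u v : Pt → ℂ} {x z ξ : Pt}
    (hu : PointwiseSource κ1 κ2 u x) (hv : PointwiseSource κ1 κ2 v z) (hx : ξ ≠ x)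
    (hz : ξ ≠ z) : ContinuousAt (radialFlux u v) ξ := by
  have hu1 := hu.reg.contDiffAt_one hx
  have hv1 := hv.reg.contDiffAt_one hz
  have hd : ∀ {f : Pt → ℂ}, ContDiffAt ℝ 1 f ξ → ContinuousAt (fun ζ => fderiv ℝ f ζ ζ) ξ :=
    fun hf => (hf.fderiv_right (m := 0) (by norm_num)).continuousAt.clm_apply continuousAt_id
  exact (hu1.continuousAt.mul (hd hv1)).sub (hv1.continuousAt.mul (hd hu1))

/-- A small cutoff around the source of `v` picks up the value of `u` there. -/
lemma exists_cutoffFlux_source {κ1 κ2 : ℝ} {u v : Pt → ℂ} {x z : Pt}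
    (hu : PointwiseSource κ1 κ2 u x) (hv : PointwiseSource κ1 κ2 v z) (hxz : x ≠ z)
    {δ : ℝ} (hδ : 0 < δ) : ∃ a b, 0 < a ∧ a < b ∧ b < ‖x - z‖ ∧
      Integrable (cutoffFlux u v z a b) ∧
      ‖(∫ ξ, cutoffFlux u v z a b ξ) - u z‖ ≤ 2 * π * δ := by
  have hlim := tendsto_flux_of_hasLogSingularity (hu.reg.contDiffAt_one hxz.symm) hv.sing
  have hev := hlim.eventually (Metric.closedBall_mem_nhds _ hδ)
  rw [eventually_nhdsWithin_iff, Metric.eventually_nhds_iff] at hev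
  obtain ⟨ε, hε, hev⟩ := hev
  have hd : 0 < ‖x - z‖ := norm_pos_iff.2 (sub_ne_zero.2 hxz)
  set m := min ε ‖x - z‖
  have hm0 : 0 < m := lt_min hε hd
  have hmε : m ≤ ε := min_le_left _ _
  have hmd : m ≤ ‖x - z‖ := min_le_right _ _
  have hne : ∀ ξ, m / 3 ≤ ‖ξ - z‖ → ‖ξ - z‖ ≤ m / 2 → ξ ≠ x ∧ ξ ≠ z := by
    refine fun ξ h1 h2 => ⟨?_, ?_⟩
    · rintro rfl; linarith
    · rintro rfl; rw [sub_self, norm_zero] at h1; linarith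
  have hc : ∀ e ξ, m / 3 ≤ ‖ξ - z‖ → ‖ξ - z‖ ≤ m / 2 → ContinuousAt (wronskian u v e) ξ :=
    fun e ξ h1 h2 => hu.continuousAt_wronskian hv (hne ξ h1 h2).1 (hne ξ h1 h2).2 e
  obtain ⟨h1, h2⟩ := integrable_and_norm_integral_cutoff_add_le (a := m / 3) (b := m / 2)
    (by linarith) (by linarith) z (hc (pt 1 0)) (hc (pt 0 1))
    (f0 := fun _ => -((1 / (2 * π) : ℝ) : ℂ) * u z) continuous_const (δ := δ)
    (fun r hr θ _ => by
      have hr0 : 0 < r := by linarith [hr.1]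
      have hn := norm_ptc hr0.le θ
      have hnz : z + ptc r θ ≠ z := by
        intro h
        rw [add_eq_left] at h
        rw [h, norm_zero] at hn
        linarith
      have := hev (y := z + ptc r θ) (by
        rw [dist_eq_norm, add_sub_cancel_left, hn]; linarith [hr.2]) hnz
      rw [dist_eq_norm, add_sub_cancel_left] at this
      rwa [wronskian_radial])
  refine ⟨m / 3, m / 2, by linarith, by linarith, by linarith, h1, ?_⟩
  have hconst : ∫ _ in (-π)..π, -((1 / (2 * π) : ℝ) : ℂ) * u z = -u z := by
    rw [intervalIntegral.integral_const, Complex.real_smul]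
    have : (π : ℂ) ≠ 0 := Complex.ofReal_ne_zero.2 pi_ne_zero
    push_cast
    field_simp
    ring
  rw [hconst, ← sub_eq_add_neg] at h2
  exact h2

/-- A cutoff at radius about `ρ` picks up the flux through the circle of radius `ρ`. -/
lemma exists_cutoffFlux_circle {κ1 κ2 : ℝ} {u v : Pt → ℂ} {x z : Pt}
    (hu : PointwiseSource κ1 κ2 u x) (hv : PointwiseSource κ1 κ2 v z) {ρ : ℝ}
    (hx : ‖x‖ < ρ) (hz : ‖z‖ < ρ) {δ : ℝ} (hδ : 0 < δ) :
    ∃ a b, ‖x‖ < a ∧ ‖z‖ < a ∧ a < b ∧ Integrable (cutoffFlux u v 0 a b) ∧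
      ‖(∫ ξ, cutoffFlux u v 0 a b ξ) + ∫ θ in (-π)..π, radialFlux u v (ptc ρ θ)‖ ≤
        2 * π * δ := by
  have hρ : 0 < ρ := (norm_nonneg x).trans_lt hx
  have hne : ∀ ξ : Pt, ‖x‖ < ‖ξ‖ → ‖z‖ < ‖ξ‖ → ξ ≠ x ∧ ξ ≠ z := fun ξ h1 h2 =>
    ⟨fun h => h1.ne (by rw [h]), fun h => h2.ne (by rw [h])⟩
  have hcF : ∀ θ, ContinuousAt (radialFlux u v) (ptc ρ θ) := fun θ => by
    have hn := norm_ptc hρ.le θ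
    obtain ⟨h1, h2⟩ := hne (ptc ρ θ) (by rwa [hn]) (by rwa [hn])
    exact hu.continuousAt_radialFlux hv h1 h2
  have hcirc : Continuous fun θ => ptc ρ θ := continuous_ptc.comp (Continuous.prodMk_right ρ)
  have hf0 : Continuous fun θ => radialFlux u v (ptc ρ θ) :=
    continuous_iff_continuousAt.2 fun θ => (hcF θ).comp hcirc.continuousAt
  have hev : ∀ᶠ r in 𝓝 ρ, ∀ θ ∈ Set.Icc (-π) π,
      ‖radialFlux u v (ptc r θ) - radialFlux u v (ptc ρ θ)‖ < δ := by
    refine isCompact_Icc.eventually_forall_of_forall_eventually fun θ _ => ?_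
    have c1 : ContinuousAt (fun p : ℝ × ℝ => radialFlux u v (ptc p.1 p.2)) (ρ, θ) :=
      ContinuousAt.comp (x := (ρ, θ)) (f := fun p : ℝ × ℝ => ptc p.1 p.2) (g := radialFlux u v)
        (hcF θ) continuous_ptc.continuousAt
    have c2 : ContinuousAt (fun p : ℝ × ℝ => radialFlux u v (ptc ρ p.2)) (ρ, θ) :=
      (hf0.comp continuous_snd).continuousAt
    have c3 := (c1.sub c2).norm
    exact c3.eventually_lt_const (by simpa using hδ)
  obtain ⟨ε, hε, hev⟩ := Metric.eventually_nhds_iff.1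
    (hev.and ((lt_mem_nhds hx).and (lt_mem_nhds hz)))
  have hball : ∀ r, ρ - ε / 2 ≤ r → r ≤ ρ + ε / 2 → dist r ρ < ε := fun r h1 h2 => by
    rw [Real.dist_eq, abs_lt]; constructor <;> linarith
  obtain ⟨-, hxa, hza⟩ := hev (hball (ρ - ε / 2) le_rfl (by linarith))
  have ha : 0 < ρ - ε / 2 := (norm_nonneg x).trans_lt hxa
  have hc : ∀ e ξ, ρ - ε / 2 ≤ ‖ξ - 0‖ → ‖ξ - 0‖ ≤ ρ + ε / 2 →
      ContinuousAt (wronskian u v e) ξ := fun e ξ h1 _ => by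
    rw [sub_zero] at h1
    obtain ⟨h3, h4⟩ := hne ξ (by linarith) (by linarith)
    exact hu.continuousAt_wronskian hv h3 h4 e
  obtain ⟨h1, h2⟩ := integrable_and_norm_integral_cutoff_add_le (a := ρ - ε / 2)
    (b := ρ + ε / 2) ha (by linarith) 0 (hc (pt 1 0)) (hc (pt 0 1)) hf0 (δ := δ)
    (fun r hr θ hθ => by
      rw [wronskian_radial, zero_add]
      exact ((hev (hball r hr.1 hr.2)).1 θ hθ).le)
  exact ⟨_, _, hxa, hza, by linarith, h1, h2⟩

/-- The total flux of `u ∇v - v ∇u` through a circle enclosing both sources. -/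
lemma integral_radialFlux {κ1 κ2 : ℝ} {u v : Pt → ℂ} {x z : Pt}
    (hu : PointwiseSource κ1 κ2 u x) (hv : PointwiseSource κ1 κ2 v z) (hxz : x ≠ z) {ρ : ℝ}
    (hx : ‖x‖ < ρ) (hz : ‖z‖ < ρ) :
    ∫ θ in (-π)..π, radialFlux u v (ptc ρ θ) = v x - u z := by
  set I := ∫ θ in (-π)..π, radialFlux u v (ptc ρ θ)
  have key : ∀ δ > 0, ‖I - (v x - u z)‖ ≤ 6 * π * δ := by
    intro δ hδ
    obtain ⟨a, b, hxa, hza, hab, i0, e0⟩ := exists_cutoffFlux_circle hu hv hx hz hδ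
    obtain ⟨a₁, b₁, ha₁, hab₁, hb₁, i1, e1⟩ := exists_cutoffFlux_source hu hv hxz hδ
    obtain ⟨a₂, b₂, ha₂, hab₂, hb₂, i2, e2⟩ := exists_cutoffFlux_source hv hu hxz.symm hδ
    have ha : 0 < a := (norm_nonneg x).trans_lt hxa
    simp only [cutoffFlux_swap u v, integral_neg] at e2
    have i2' : Integrable (cutoffFlux u v x a₂ b₂) := by
      have := i2.neg
      refine this.congr (.of_forall fun ξ => ?_)
      simp [cutoffFlux_swap u v]
    set χ : Pt → ℂ := cutoff 0 a b - cutoff z a₁ b₁ - cutoff x a₂ b₂ with hχ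
    have hd : ∀ c a b ξ, DifferentiableAt ℝ (cutoff c a b) ξ := fun c a b ξ =>
      (contDiff_cutoff c).differentiable (by norm_num) ξ
    have hχ1 : ContDiff ℝ 1 χ :=
      ((contDiff_cutoff 0).sub (contDiff_cutoff z)).sub (contDiff_cutoff x)
    have hχs : HasCompactSupport χ :=
      ((hasCompactSupport_cutoff ha hab 0).sub (hasCompactSupport_cutoff ha₁ hab₁ z)).sub
        (hasCompactSupport_cutoff ha₂ hab₂ x)
    have hlt : ∀ (c p : Pt) (r : ℝ), ‖p - c‖ < r → ∀ᶠ ξ in 𝓝 p, ‖ξ - c‖ < r := fun c p r h =>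
      (by fun_prop : Continuous fun ξ : Pt => ‖ξ - c‖).continuousAt.eventually_lt_const h
    have hgt : ∀ (c p : Pt) (r : ℝ), r < ‖p - c‖ → ∀ᶠ ξ in 𝓝 p, r < ‖ξ - c‖ := fun c p r h =>
      (by fun_prop : Continuous fun ξ : Pt => ‖ξ - c‖).continuousAt.eventually_const_lt h
    have hχx : x ∉ tsupport χ := by
      rw [notMem_tsupport_iff_eventuallyEq]
      filter_upwards [hlt 0 x a (by simpa),
        hgt z x _ hb₁,
        hlt x x a₂ (by simpa)] with ξ h0 h1 h2
      simp [hχ, cutoff_eq_one ha hab 0 h0.le, cutoff_eq_zero ha₁ hab₁ z h1.le,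
        cutoff_eq_one ha₂ hab₂ x h2.le]
    have hχz : z ∉ tsupport χ := by
      rw [notMem_tsupport_iff_eventuallyEq]
      filter_upwards [hlt 0 z a (by simpa),
        hgt x z _ hb₂,
        hlt z z a₁ (by simpa)] with ξ h0 h1 h2
      simp [hχ, cutoff_eq_one ha hab 0 h0.le, cutoff_eq_zero ha₂ hab₂ x h1.le,
        cutoff_eq_one ha₁ hab₁ z h2.le]
    have hzero := integral_grad_wronskian_eq_zero hu hv hχ1 hχs hχx hχz
    have hfd : ∀ ξ e, fderiv ℝ χ ξ e = fderiv ℝ (cutoff 0 a b) ξ e -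
        fderiv ℝ (cutoff z a₁ b₁) ξ e - fderiv ℝ (cutoff x a₂ b₂) ξ e := fun ξ e => by
      rw [hχ, fderiv_sub ((hd _ _ _ ξ).sub (hd _ _ _ ξ)) (hd _ _ _ ξ),
        fderiv_sub (hd _ _ _ ξ) (hd _ _ _ ξ)]
      rfl
    have hsplit : (∫ ξ, cutoffFlux u v 0 a b ξ) - (∫ ξ, cutoffFlux u v z a₁ b₁ ξ) -
        (∫ ξ, cutoffFlux u v x a₂ b₂ ξ) = 0 := by
      rw [← integral_sub i0 i1,
        ← integral_sub (f := fun ξ => cutoffFlux u v 0 a b ξ - cutoffFlux u v z a₁ b₁ ξ)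
          (i0.sub i1) i2', ← hzero]
      refine integral_congr_ae (.of_forall fun ξ => ?_)
      simp only [hfd, cutoffFlux]
      ring
    set J0 := ∫ ξ, cutoffFlux u v 0 a b ξ
    set J1 := ∫ ξ, cutoffFlux u v z a₁ b₁ ξ
    set J2 := ∫ ξ, cutoffFlux u v x a₂ b₂ ξ
    calc ‖I - (v x - u z)‖ = ‖(J0 + I) - (J1 - u z) + (-J2 - v x)‖ := by
          congr 1
          linear_combination -hsplit
      _ ≤ ‖J0 + I‖ + ‖J1 - u z‖ + ‖-J2 - v x‖ :=
          (norm_add_le _ _).trans (by gcongr; exact norm_sub_le _ _)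
      _ ≤ 2 * π * δ + 2 * π * δ + 2 * π * δ := by gcongr
      _ = 6 * π * δ := by ring
  have : ‖I - (v x - u z)‖ ≤ 0 := le_of_forall_pos_le_add fun ε hε => by
    have h6 : 0 < 6 * π := by positivity
    have := key (ε / (6 * π)) (by positivity)
    rwa [mul_div_cancel₀ _ h6.ne', ← zero_add ε] at this
  exact sub_eq_zero.1 (norm_le_zero_iff.1 this)

lemma dnu_mul_norm (F : Pt → ℂ) {ξ : Pt} (h : ξ ≠ 0) : dnu F ξ * (‖ξ‖ : ℂ) = fderiv ℝ F ξ ξ := by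
  have hn : (‖ξ‖ : ℂ) ≠ 0 := Complex.ofReal_ne_zero.2 (norm_ne_zero_iff.2 h)
  rw [dnu, map_smul, Complex.real_smul, Complex.ofReal_inv]
  field_simp

/-- Green's second identity for two point sources on a circle enclosing them. -/
lemma circInt_green {κ1 κ2 : ℝ} {u v : Pt → ℂ} {x z : Pt}
    (hu : PointwiseSource κ1 κ2 u x) (hv : PointwiseSource κ1 κ2 v z) (hxz : x ≠ z) {ρ : ℝ}
    (hx : ‖x‖ < ρ) (hz : ‖z‖ < ρ) :
    circInt ρ (fun ξ => u ξ * dnu v ξ - dnu u ξ * v ξ) = v x - u z := by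
  have hρ : 0 < ρ := (norm_nonneg x).trans_lt hx
  rw [← integral_radialFlux hu hv hxz hx hz, circInt]
  have hper : Function.Periodic (fun θ => radialFlux u v (ptc ρ θ)) (2 * π) := fun θ => by
    simp only [ptc, Real.cos_add_two_pi, Real.sin_add_two_pi]
  have h := hper.intervalIntegral_add_eq 0 (-π)
  rw [zero_add, show -π + 2 * π = π by ring] at h
  rw [← h]
  refine intervalIntegral.integral_congr fun θ _ => ?_
  have hn := norm_ptc hρ.le θ
  have h0 : ptc ρ θ ≠ 0 := norm_pos_iff.1 (by rwa [hn])
  have h1 := dnu_mul_norm u h0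
  have h2 := dnu_mul_norm v h0
  rw [hn] at h1 h2
  simp only [radialFlux, ← h1, ← h2]
  ring

/-- Reciprocity for radiating point sources. -/
lemma RadiationDecay.reciprocity {κ1 κ2 : ℝ} {u v : Pt → ℂ} {x z : Pt}
    (hu : PointwiseSource κ1 κ2 u x) (hv : PointwiseSource κ1 κ2 v z) (hxz : x ≠ z)
    (hur : RadiationDecay κ1 κ2 u) (hvr : RadiationDecay κ1 κ2 v) : v x = u z := by
  obtain ⟨C, hC, r, hr, hu'⟩ := hur
  obtain ⟨C', hC', r', hr', hv'⟩ := hvr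
  have hlim : Tendsto (fun ρ : ℝ => 2 * C * C' * (2 * π) * ρ⁻¹) atTop (𝓝 0) := by
    simpa using tendsto_inv_atTop_zero.const_mul (2 * C * C' * (2 * π))
  have hle : ∀ᶠ ρ in atTop, ‖v x - u z‖ ≤ 2 * C * C' * (2 * π) * ρ⁻¹ := by
    filter_upwards [eventually_ge_atTop r, eventually_ge_atTop r', eventually_gt_atTop ‖x‖,
      eventually_gt_atTop ‖z‖] with ρ h1 h2 hx hz
    have hρ : 0 < ρ := hr.trans_le h1
    have hpow : ρ ^ (-(1 / 2) : ℝ) * ρ ^ (-(3 / 2) : ℝ) * ρ = ρ⁻¹ := by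
      rw [← Real.rpow_add hρ, ← Real.rpow_add_one hρ.ne', ← Real.rpow_neg_one]
      norm_num
    rw [← circInt_green hu hv hxz hx hz, circInt]
    refine (intervalIntegral.norm_integral_le_of_norm_le_const (C := 2 * C * C' * ρ⁻¹)
      fun θ _ => ?_).trans_eq ?_
    · have hn := norm_ptc hρ.le θ
      set ξ := ptc ρ θ
      obtain ⟨u1, u2⟩ := hu' ξ (by rwa [hn])
      obtain ⟨v1, v2⟩ := hv' ξ (by rwa [hn])
      rw [hn] at u1 u2 v1 v2
      set s : ℂ := Complex.I * ((kappa0 κ1 κ2 ξ : ℝ) : ℂ)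
      rw [norm_mul, Complex.norm_real, norm_of_nonneg hρ.le]
      have hsplit : u ξ * dnu v ξ - dnu u ξ * v ξ =
          u ξ * (dnu v ξ - s * v ξ) - (dnu u ξ - s * u ξ) * v ξ := by ring
      rw [hsplit]
      calc _ ≤ (C * ρ ^ (-(1 / 2) : ℝ) * (C' * ρ ^ (-(3 / 2) : ℝ)) +
            C * ρ ^ (-(3 / 2) : ℝ) * (C' * ρ ^ (-(1 / 2) : ℝ))) * ρ := by
            gcongr
            refine (norm_sub_le _ _).trans ?_
            rw [norm_mul, norm_mul]
            gcongr
        _ = 2 * C * C' * (ρ ^ (-(1 / 2) : ℝ) * ρ ^ (-(3 / 2) : ℝ) * ρ) := by ring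
        _ = _ := by rw [hpow]
    · rw [sub_zero, abs_of_pos (by positivity)]
      ring
  have := ge_of_tendsto hlim hle
  exact sub_eq_zero.1 (norm_le_zero_iff.1 this)

/-- Lemma 2.1: the modified Helmholtz–Kirchhoff identity
∫_{∂B_R} ( conj(G(ξ,x)) ∂_νG(ξ,z) − conj(∂_νG(ξ,x)) G(ξ,z) ) ds(ξ) = 2i·Im G(x,z). -/
theorem modified_helmholtz_kirchhoff
    (κ1 κ2 : ℝ) (hκ1 : 0 < κ1) (hκ2 : 0 < κ2)
    (G : Pt → Pt → ℂ)
    (hGloc : ∀ y : Pt, y 1 ≠ 0 → LocallyIntegrable (fun ξ => G ξ y) volume)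
    (hGsol : ∀ y : Pt, y 1 ≠ 0 → IsPointSourceSol κ1 κ2 (fun ξ => G ξ y) y)
    (hGsing : ∀ y : Pt, y 1 ≠ 0 → HasLogSingularity (fun ξ => G ξ y) y)
    (hGreg : ∀ y : Pt, y 1 ≠ 0 → SourceRegular (fun ξ => G ξ y) y)
    (hGrad : ∀ y : Pt, y 1 ≠ 0 → RadiationDecay κ1 κ2 (fun ξ => G ξ y))
    (R : ℝ) (hR : 0 < R) (x z : Pt) (hxR : ‖x‖ < R) (hzR : ‖z‖ < R)
    (hx2 : x 1 ≠ 0) (hz2 : z 1 ≠ 0) (hxz : x ≠ z) :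
    circInt R (fun ξ =>
        (starRingEnd ℂ) (G ξ x) * dnu (fun ξ' => G ξ' z) ξ
          - (starRingEnd ℂ) (dnu (fun ξ' => G ξ' x) ξ) * G ξ z)
      = 2 * Complex.I * (((G x z).im : ℝ) : ℂ) := by
  have hx := (hGsol x hx2).pointwiseSource (hGreg x hx2) (hGsing x hx2)
  have hz := (hGsol z hz2).pointwiseSource (hGreg z hz2) (hGsing z hz2)
  have hrec : G x z = G z x :=
    RadiationDecay.reciprocity (u := fun ξ => G ξ x) (v := fun ξ => G ξ z) hx hz hxz
      (hGrad x hx2) (hGrad z hz2)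
  have h := circInt_green hx.conj hz hxz hxR hzR
  simp only [dnu, fderiv_conj_apply] at h
  simp only [dnu]
  rw [h, ← hrec, Complex.sub_conj]
  push_cast
  ring

end
end

section
/- (Rellich-type boundedness of circle integrals, claim (2.29) of the paper) Let V : ℝ² → ℂ be C¹ outside a compact set and assume: (i) sup_{|ξ| = ρ} |ξ|^{1/2} |∇V(ξ)·(ξ/|ξ|) − i κ₀(ξ) V(ξ)| → 0 as ρ → ∞; (ii) there is L ∈ ℝ such that Im ∫_{∂B_ρ} V(ξ) conj(∂_νV(ξ)) ds(ξ) → L as ρ → ∞. Then lim_{ρ→∞} ∫_{∂B_ρ} ( κ₀(ξ)^{−1} |∂_νV(ξ)|² + κ₀(ξ) |V(ξ)|² ) ds(ξ) = −2L; in particular, ∫_{∂B_ρ} |V(ξ)|² ds(ξ) remains bounded as ρ → ∞. -/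
noncomputable section
open MeasureTheory Real Filter Topology

/-- The circle of radius `ρ` consists of points of norm `ρ`. -/
theorem norm_ptc_s8 {ρ : ℝ} (hρ : 0 ≤ ρ) (θ : ℝ) : ‖ptc ρ θ‖ = ρ := by
  rw [EuclideanSpace.norm_eq, Fin.sum_univ_two]
  have h : ‖(ptc ρ θ) 0‖ ^ 2 + ‖(ptc ρ θ) 1‖ ^ 2 = ρ ^ 2 := by
    simp only [ptc, pt, WithLp.equiv_symm_apply, Real.norm_eq_abs, sq_abs, Matrix.cons_val_zero,
      Matrix.cons_val_one]
    linear_combination ρ ^ 2 * Real.cos_sq_add_sin_sq θ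
  rw [h, Real.sqrt_sq hρ]

theorem continuous_ptc_s8 (ρ : ℝ) : Continuous (ptc ρ) := by
  refine (PiLp.continuous_toLp 2 _).comp (continuous_pi fun i => ?_)
  fin_cases i <;> simp <;> fun_prop

theorem measurable_kappa0 (κ1 κ2 : ℝ) : Measurable (kappa0 κ1 κ2) := by
  refine Measurable.ite ?_ measurable_const measurable_const
  exact measurableSet_lt measurable_const (by fun_prop)

theorem kappa0_pos {κ1 κ2 : ℝ} (hκ1 : 0 < κ1) (hκ2 : 0 < κ2) (x : Pt) :
    0 < kappa0 κ1 κ2 x := by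
  unfold kappa0; split_ifs <;> assumption

theorem min_le_kappa0 (κ1 κ2 : ℝ) (x : Pt) : min κ1 κ2 ≤ kappa0 κ1 κ2 x := by
  unfold kappa0; split_ifs <;> simp

/-- Functions of the wavenumber are integrable on circles. -/
theorem intervalIntegrable_comp_kappa0 (κ1 κ2 : ℝ) (f : ℝ → ℝ) (hf : Measurable f)
    (ρ a b : ℝ) :
    IntervalIntegrable (fun θ => f (kappa0 κ1 κ2 (ptc ρ θ))) volume a b := by
  refine (intervalIntegrable_const (c := max |f κ1| |f κ2|)).mono_fun ?_ ?_
  · exact (hf.comp ((measurable_kappa0 κ1 κ2).comp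
      (continuous_ptc_s8 ρ).measurable)).aestronglyMeasurable
  · refine Eventually.of_forall fun θ => ?_
    refine le_trans ?_ (le_abs_self _)
    unfold kappa0
    simp only [Real.norm_eq_abs]
    split_ifs <;> simp

theorem continuousOn_dnu {V : Pt → ℂ} {U : Set Pt} (hU : IsOpen U) (h0 : (0 : Pt) ∉ U)
    (hV : ContDiffOn ℝ 1 V U) : ContinuousOn (dnu V) U := by
  refine (hV.continuousOn_fderiv_of_isOpen hU le_rfl).clm_apply ?_
  refine (continuousOn_id.norm.inv₀ fun x hx => ?_).smul continuousOn_id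
  exact norm_ne_zero_iff.2 fun h => h0 (h ▸ hx)

/-- Expanding the square of the radiation remainder. -/
theorem energy_eq_remainder_sub {k : ℝ} (hk : 0 < k) (v d : ℂ) :
    k⁻¹ * ‖d‖ ^ 2 + k * ‖v‖ ^ 2
      = k⁻¹ * ‖d - Complex.I * (k : ℂ) * v‖ ^ 2 - 2 * (v * (starRingEnd ℂ) d).im := by
  simp only [← Complex.normSq_eq_norm_sq, Complex.normSq_apply]
  simp
  field_simp
  ring

theorem circIntR_mono {ρ : ℝ} (hρ : 0 ≤ ρ) {F G : Pt → ℝ}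
    (hF : IntervalIntegrable (fun θ => F (ptc ρ θ) * ρ) volume 0 (2 * π))
    (hG : IntervalIntegrable (fun θ => G (ptc ρ θ) * ρ) volume 0 (2 * π))
    (h : ∀ ξ, ‖ξ‖ = ρ → F ξ ≤ G ξ) : circIntR ρ F ≤ circIntR ρ G :=
  intervalIntegral.integral_mono_on (by positivity) hF hG fun θ _ =>
    mul_le_mul_of_nonneg_right (h _ (norm_ptc_s8 hρ θ)) hρ

/-- claim (2.29): Rellich-type boundedness. If the radiation remainder decays
uniformly and Im ∫_{∂B_ρ} V conj(∂_νV) ds → L, then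
∫_{∂B_ρ} (κ₀⁻¹|∂_νV|² + κ₀|V|²) ds → −2L; in particular ∫_{∂B_ρ} |V|² ds stays bounded. -/
theorem rellich_boundedness
    (κ1 κ2 : ℝ) (hκ1 : 0 < κ1) (hκ2 : 0 < κ2)
    (V : Pt → ℂ) (K : Set Pt) (hK : IsCompact K) (hV : ContDiffOn ℝ 1 V Kᶜ)
    (hrad : ∀ ε > (0:ℝ), ∃ ρ₂ > (0:ℝ), ∀ ξ : Pt, ρ₂ ≤ ‖ξ‖ →
      ‖ξ‖ ^ ((1:ℝ)/2) * ‖dnu V ξ - Complex.I * ((kappa0 κ1 κ2 ξ : ℝ) : ℂ) * V ξ‖ ≤ ε)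
    (L : ℝ)
    (hL : Tendsto (fun ρ => (circInt ρ (fun ξ => V ξ * (starRingEnd ℂ) (dnu V ξ))).im)
      atTop (𝓝 L)) :
    Tendsto (fun ρ => circIntR ρ (fun ξ =>
        (kappa0 κ1 κ2 ξ)⁻¹ * ‖dnu V ξ‖ ^ 2 + kappa0 κ1 κ2 ξ * ‖V ξ‖ ^ 2))
      atTop (𝓝 (-2 * L)) ∧
    ∃ M : ℝ, ∀ᶠ ρ in atTop, circIntR ρ (fun ξ => ‖V ξ‖ ^ 2) ≤ M := by
  set m := min κ1 κ2
  have hm0 : 0 < m := lt_min hκ1 hκ2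
  obtain ⟨R, hR⟩ := hK.isBounded.subset_closedBall (0 : Pt)
  set R' := max R 0 with hR'
  have hUo : IsOpen (Metric.closedBall (0 : Pt) R')ᶜ := Metric.isClosed_closedBall.isOpen_compl
  have hVU : ContDiffOn ℝ 1 V (Metric.closedBall (0 : Pt) R')ᶜ :=
    hV.mono (Set.compl_subset_compl.2
      (hR.trans (Metric.closedBall_subset_closedBall (le_max_left _ _))))
  have hDU : ContinuousOn (dnu V) (Metric.closedBall (0 : Pt) R')ᶜ :=
    continuousOn_dnu hUo (by simp [hR']) hVU
  have hmem : ∀ ρ, R' < ρ → ∀ θ, ptc ρ θ ∈ (Metric.closedBall (0 : Pt) R')ᶜ := by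
    intro ρ hρ θ
    simpa [norm_ptc_s8 ((le_max_right R 0).trans hρ.le)] using hρ
  have hVc : ∀ ρ, R' < ρ → Continuous fun θ => V (ptc ρ θ) := fun ρ hρ =>
    hVU.continuousOn.comp_continuous (continuous_ptc_s8 ρ) (hmem ρ hρ)
  have hDc : ∀ ρ, R' < ρ → Continuous fun θ => dnu V (ptc ρ θ) := fun ρ hρ =>
    hDU.comp_continuous (continuous_ptc_s8 ρ) (hmem ρ hρ)
  set E : Pt → ℝ := fun ξ =>
    (kappa0 κ1 κ2 ξ)⁻¹ * ‖dnu V ξ‖ ^ 2 + kappa0 κ1 κ2 ξ * ‖V ξ‖ ^ 2 with hE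
  set W : Pt → ℝ := fun ξ =>
    (kappa0 κ1 κ2 ξ)⁻¹ * ‖dnu V ξ - Complex.I * ((kappa0 κ1 κ2 ξ : ℝ) : ℂ) * V ξ‖ ^ 2 with hW
  have hEW : ∀ ξ, E ξ = W ξ - 2 * (V ξ * (starRingEnd ℂ) (dnu V ξ)).im := fun ξ =>
    energy_eq_remainder_sub (kappa0_pos hκ1 hκ2 ξ) _ _
  have hEi : ∀ ρ, R' < ρ →
      IntervalIntegrable (fun θ => E (ptc ρ θ) * ρ) volume 0 (2 * π) := by
    intro ρ hρ
    have hc1 := hVc ρ hρ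
    have hc2 := hDc ρ hρ
    refine IntervalIntegrable.mul_const ?_ _
    refine IntervalIntegrable.add ?_ ?_
    · exact (intervalIntegrable_comp_kappa0 κ1 κ2 (·⁻¹) measurable_inv ρ _ _).mul_continuousOn
        (hc2.norm.pow 2).continuousOn
    · exact (intervalIntegrable_comp_kappa0 κ1 κ2 id measurable_id ρ _ _).mul_continuousOn
        (hc1.norm.pow 2).continuousOn
  have hFc : ∀ ρ, R' < ρ →
      Continuous fun θ => V (ptc ρ θ) * (starRingEnd ℂ) (dnu V (ptc ρ θ)) * (ρ : ℂ) :=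
    fun ρ hρ => ((hVc ρ hρ).mul (Complex.continuous_conj.comp (hDc ρ hρ))).mul continuous_const
  have hFi : ∀ ρ, R' < ρ → IntervalIntegrable
      (fun θ => 2 * (V (ptc ρ θ) * (starRingEnd ℂ) (dnu V (ptc ρ θ)) * (ρ : ℂ)).im)
      volume 0 (2 * π) := fun ρ hρ =>
    (continuous_const.mul (Complex.continuous_im.comp (hFc ρ hρ))).intervalIntegrable _ _
  have hWe : ∀ ρ, (fun θ => W (ptc ρ θ) * ρ) = fun θ => E (ptc ρ θ) * ρ +
      2 * (V (ptc ρ θ) * (starRingEnd ℂ) (dnu V (ptc ρ θ)) * (ρ : ℂ)).im := by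
    intro ρ
    ext θ
    rw [hEW, Complex.im_mul_ofReal]
    ring
  have hWi : ∀ ρ, R' < ρ →
      IntervalIntegrable (fun θ => W (ptc ρ θ) * ρ) volume 0 (2 * π) := by
    intro ρ hρ
    rw [hWe]
    exact (hEi ρ hρ).add (hFi ρ hρ)
  have hkey : ∀ ρ, R' < ρ → circIntR ρ E = circIntR ρ W
      - 2 * (circInt ρ (fun ξ => V ξ * (starRingEnd ℂ) (dnu V ξ))).im := by
    intro ρ hρ
    have him : (circInt ρ (fun ξ => V ξ * (starRingEnd ℂ) (dnu V ξ))).im =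
        ∫ θ in (0:ℝ)..(2 * π),
          (V (ptc ρ θ) * (starRingEnd ℂ) (dnu V (ptc ρ θ)) * (ρ : ℂ)).im :=
      (Complex.imCLM.intervalIntegral_comp_comm ((hFc ρ hρ).intervalIntegrable _ _)).symm
    have hWint : circIntR ρ W = circIntR ρ E + 2 * ∫ θ in (0:ℝ)..(2 * π),
        (V (ptc ρ θ) * (starRingEnd ℂ) (dnu V (ptc ρ θ)) * (ρ : ℂ)).im := by
      unfold circIntR
      rw [hWe, intervalIntegral.integral_add (hEi ρ hρ) (hFi ρ hρ),
        intervalIntegral.integral_const_mul]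
    rw [him, hWint]
    ring
  have hWlim : Tendsto (fun ρ => circIntR ρ W) atTop (𝓝 0) := by
    have hbound : ∀ ε > (0:ℝ), ∀ᶠ ρ in atTop, circIntR ρ W ≤ m⁻¹ * ε ^ 2 * (2 * π) := by
      intro ε hε
      obtain ⟨ρ₂, hρ₂, h⟩ := hrad ε hε
      filter_upwards [eventually_gt_atTop R', eventually_ge_atTop ρ₂] with ρ hρ hρ'
      have hρ0 : 0 < ρ := hρ₂.trans_le hρ'
      have hle : circIntR ρ W ≤ circIntR ρ (fun _ => m⁻¹ * (ε ^ 2 / ρ)) := by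
        refine circIntR_mono hρ0.le (hWi ρ hρ) intervalIntegrable_const fun ξ hξ => ?_
        have h1 := h ξ (by rw [hξ]; exact hρ')
        rw [hξ, ← Real.sqrt_eq_rpow] at h1
        have h2 := pow_le_pow_left₀ (by positivity) h1 2
        rw [mul_pow, Real.sq_sqrt hρ0.le] at h2
        have h3 : ‖dnu V ξ - Complex.I * ((kappa0 κ1 κ2 ξ : ℝ) : ℂ) * V ξ‖ ^ 2 ≤ ε ^ 2 / ρ := by
          rw [le_div_iff₀ hρ0]; linarith
        exact mul_le_mul (inv_anti₀ hm0 (min_le_kappa0 _ _ _)) h3 (by positivity)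
          (by positivity)
      refine hle.trans_eq ?_
      simp only [circIntR, intervalIntegral.integral_const, smul_eq_mul]
      field_simp
      ring
    rw [Metric.tendsto_nhds]
    intro δ hδ
    have hc : 0 < m⁻¹ * (2 * π) := by positivity
    set ε := Real.sqrt (δ / 2 / (m⁻¹ * (2 * π))) with hεdef
    have hε : 0 < ε := by positivity
    have hε2 : m⁻¹ * ε ^ 2 * (2 * π) = δ / 2 := by
      rw [hεdef, Real.sq_sqrt (by positivity)]
      field_simp
    filter_upwards [hbound ε hε, eventually_ge_atTop 0] with ρ h1 h2
    have h0 : 0 ≤ circIntR ρ W :=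
      intervalIntegral.integral_nonneg (by positivity) fun θ _ => mul_nonneg
        (mul_nonneg (inv_nonneg.2 (kappa0_pos hκ1 hκ2 _).le) (by positivity)) h2
    rw [Real.dist_eq, sub_zero, abs_of_nonneg h0]
    linarith
  have hElim : Tendsto (fun ρ => circIntR ρ E) atTop (𝓝 (-2 * L)) := by
    have h := hWlim.sub (hL.const_mul 2)
    rw [show (0:ℝ) - 2 * L = -2 * L by ring] at h
    refine h.congr' ?_
    filter_upwards [eventually_gt_atTop R'] with ρ hρ
    exact (hkey ρ hρ).symm
  refine ⟨hElim, m⁻¹ * (-2 * L + 1), ?_⟩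
  filter_upwards [hElim.eventually_le_const (show -2 * L < -2 * L + 1 by linarith),
    eventually_gt_atTop R'] with ρ h1 hρ
  have hρ0 : 0 ≤ ρ := (le_max_right R 0).trans hρ.le
  have hle : circIntR ρ (fun ξ => ‖V ξ‖ ^ 2) ≤ circIntR ρ (fun ξ => m⁻¹ * E ξ) := by
    refine circIntR_mono hρ0 ?_ ?_ fun ξ _ => ?_
    · exact (((hVc ρ hρ).norm.pow 2).mul continuous_const).intervalIntegrable _ _
    · simpa only [mul_assoc] using (hEi ρ hρ).const_mul m⁻¹
    · rw [le_inv_mul_iff₀ hm0]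
      have h2 : m * ‖V ξ‖ ^ 2 ≤ kappa0 κ1 κ2 ξ * ‖V ξ‖ ^ 2 :=
        mul_le_mul_of_nonneg_right (min_le_kappa0 _ _ _) (by positivity)
      have h3 : 0 ≤ (kappa0 κ1 κ2 ξ)⁻¹ * ‖dnu V ξ‖ ^ 2 :=
        mul_nonneg (inv_nonneg.2 (kappa0_pos hκ1 hκ2 ξ).le) (by positivity)
      simp only [hE]
      linarith
  refine hle.trans ?_
  have h4 : circIntR ρ (fun ξ => m⁻¹ * E ξ) = m⁻¹ * circIntR ρ E := by
    simp only [circIntR, mul_assoc, intervalIntegral.integral_const_mul]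
  rw [h4]
  exact mul_le_mul_of_nonneg_left h1 (by positivity)

end
end
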